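/- arXiv:math/0304464 — 2 statements merged into one kernel-verified Lean document; each statement's English description precedes it below -/
import Mathlib

section
/- No minimally imperfect graph contains a U-cutset; that is, no minimally imperfect graph has a skew partition A, B, C, D together with vertices u, v ∈ C such that every vertex of A is adjacent to u and every vertex of B is adjacent to v. -/
open SimpleGraph

/-- A graph is perfect if, in every induced subgraph, the clique number equals
the chromatic number. -/
def IsPerfect {V : Type*} (G : SimpleGraph V) : Prop :=
  ∀ S : Set V, ((G.induce S).cliqueNum : ℕ∞) = (G.induce S).chromaticNumber

/-- A graph is minimally imperfect if it is not perfect but every proper induced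
subgraph of it is perfect. -/
def MinimallyImperfect {V : Type*} (G : SimpleGraph V) : Prop :=
  ¬ IsPerfect G ∧ ∀ S : Set V, S ≠ Set.univ → IsPerfect (G.induce S)

/-- `A, B, C, D` form a skew partition of `G`: all four sets are nonempty, they
partition the vertex set, every vertex of `A` is adjacent to every vertex of `B`,
and there are no edges between `C` and `D`. -/
def IsSkewPartition {V : Type*} (G : SimpleGraph V) (A B C D : Set V) : Prop :=
  A.Nonempty ∧ B.Nonempty ∧ C.Nonempty ∧ D.Nonempty ∧
  A ∪ B ∪ C ∪ D = Set.univ ∧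
  Disjoint A B ∧ Disjoint A C ∧ Disjoint A D ∧
  Disjoint B C ∧ Disjoint B D ∧ Disjoint C D ∧
  (∀ a ∈ A, ∀ b ∈ B, G.Adj a b) ∧
  (∀ c ∈ C, ∀ d ∈ D, ¬ G.Adj c d)

/-- A graph has a skew partition if its vertex set admits one. -/
def HasSkewPartition {V : Type*} (G : SimpleGraph V) : Prop :=
  ∃ A B C D : Set V, IsSkewPartition G A B C D

/-- Every clique of `G` contained in `S` has at most `k` vertices. -/
def CliqueBoundOn {V : Type*} (G : SimpleGraph V) (S : Set V) (k : ℕ) : Prop :=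
  ∀ t : Finset V, ↑t ⊆ S → G.IsClique (t : Set V) → t.card ≤ k

/-- `c` is a proper colouring of the subgraph of `G` induced by `S`, with colours below `k`. -/
def ProperOn {V : Type*} (G : SimpleGraph V) (S : Set V) (k : ℕ) (c : V → ℕ) : Prop :=
  (∀ x ∈ S, c x < k) ∧ ∀ x ∈ S, ∀ y ∈ S, G.Adj x y → c x ≠ c y

/-- The subgraph of `G` induced by `S` can be coloured with as many colours as any upper bound
on the size of its cliques. -/
def OmegaColorableOn {V : Type*} (G : SimpleGraph V) (S : Set V) : Prop :=
  ∀ k, CliqueBoundOn G S k → ∃ c, ProperOn G S k c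

lemma ProperOn.injOn_of_isClique {V : Type*} {G : SimpleGraph V} {S : Set V} {k : ℕ} {c : V → ℕ}
    (hc : ProperOn G S k c) {t : Set V} (htS : t ⊆ S) (ht : G.IsClique t) : Set.InjOn c t := by
  intro x hx y hy hxy
  by_contra hne
  exact hc.2 x (htS hx) y (htS hy) (ht hx hy hne) hxy

lemma exists_properOn_iff {V : Type*} (G : SimpleGraph V) (S : Set V) (k : ℕ) :
    (∃ c, ProperOn G S k c) ↔ (G.induce S).Colorable k := by
  classical
  constructor
  · rintro ⟨c, hc⟩
    exact ⟨Coloring.mk (fun x => ⟨c x, hc.1 x x.2⟩) fun {x y} h he =>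
      hc.2 x x.2 y y.2 h (by simpa using he)⟩
  · rintro ⟨c⟩
    refine ⟨fun x => if h : x ∈ S then c ⟨x, h⟩ else 0, ?_, ?_⟩
    · intro x hx
      simp [hx]
    · intro x hx y hy h
      simp only [hx, hy, dif_pos, ne_eq, Fin.val_inj]
      exact c.valid (by simpa using h)

lemma cliqueNum_le_of_cliqueBoundOn {V : Type*} {G : SimpleGraph V} {S : Set V}
    {k : ℕ} (h : CliqueBoundOn G S k) [Finite V] : (G.induce S).cliqueNum ≤ k := by
  obtain ⟨s, hs⟩ := (G.induce S).exists_isNClique_cliqueNum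
  rw [isNClique_induce_iff] at hs
  rw [← hs.card_eq]
  exact h _ (by intro x hx; simp at hx; exact hx.1) hs.isClique

lemma cliqueBoundOn_univ_cliqueNum {V : Type*} [Finite V] (G : SimpleGraph V) :
    CliqueBoundOn G Set.univ G.cliqueNum := fun _ _ h => h.card_le_cliqueNum

lemma cliqueNum_induce_univ {V : Type*} (G : SimpleGraph V) :
    (G.induce Set.univ).cliqueNum = G.cliqueNum := by
  unfold cliqueNum
  congr 1
  ext n
  simp only [Set.mem_ofPred_eq]
  rw [← not_iff_not, not_exists, not_exists]
  change (G.induce Set.univ).CliqueFree n ↔ G.CliqueFree n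
  rw [cliqueFree_induce_iff, cliqueFreeOn_univ]

lemma IsPerfect.chromaticNumber_eq {V : Type*} {G : SimpleGraph V} (h : IsPerfect G) :
    (G.cliqueNum : ℕ∞) = G.chromaticNumber := by
  rw [← chromaticNumber_congr G.induceUnivIso, ← cliqueNum_induce_univ, h Set.univ]

lemma MinimallyImperfect.omegaColorableOn {V : Type*} [Finite V] {G : SimpleGraph V}
    (hmi : MinimallyImperfect G) {S : Set V} (hS : S ≠ Set.univ) : OmegaColorableOn G S := by
  intro k hk
  rw [exists_properOn_iff, ← chromaticNumber_le_iff_colorable,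
    ← (hmi.2 S hS).chromaticNumber_eq]
  exact_mod_cast cliqueNum_le_of_cliqueBoundOn hk

lemma MinimallyImperfect.not_colorable {V : Type*} {G : SimpleGraph V}
    (hmi : MinimallyImperfect G) : ¬ ∃ c, ProperOn G Set.univ G.cliqueNum c := by
  intro h
  rw [exists_properOn_iff] at h
  replace h : G.Colorable G.cliqueNum := h.of_hom G.induceUnivIso.symm.toHom
  refine hmi.1 fun S => ?_
  by_cases hS : S = Set.univ
  · subst hS
    refine le_antisymm cliqueNum_le_chromaticNumber ?_
    rw [chromaticNumber_congr G.induceUnivIso, cliqueNum_induce_univ]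
    exact chromaticNumber_le_iff_colorable.2 h
  · exact (hmi.2 S hS).chromaticNumber_eq

lemma OmegaColorableOn.of_injOn {V W : Type*} {G : SimpleGraph V} {H : SimpleGraph W}
    {T : Set W} {f : W → V} (hf : Set.InjOn f T)
    (hadj : ∀ x ∈ T, ∀ y ∈ T, H.Adj x y ↔ G.Adj (f x) (f y))
    (hG : OmegaColorableOn G (f '' T)) : OmegaColorableOn H T := by
  classical
  intro k hk
  obtain ⟨c, hc⟩ := hG k (by
    intro t ht htc
    obtain ⟨s, hs, rfl⟩ := Finset.subset_set_image_iff.1 ht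
    rw [Finset.card_image_of_injOn (hf.mono hs)]
    refine hk s hs fun x hx y hy hne => ?_
    rw [hadj x (hs hx) y (hs hy)]
    exact htc (by simpa using ⟨x, hx, rfl⟩) (by simpa using ⟨y, hy, rfl⟩)
      fun h => hne (hf (hs hx) (hs hy) h))
  refine ⟨c ∘ f, fun x hx => hc.1 _ ⟨x, hx, rfl⟩, fun x hx y hy h => ?_⟩
  exact hc.2 _ ⟨x, hx, rfl⟩ _ ⟨y, hy, rfl⟩ ((hadj x hx y hy).1 h)

/-- A colouring extends to a vertex dominated by one of its non-neighbours. -/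
lemma OmegaColorableOn.of_dominated {W : Type*} {H : SimpleGraph W} {T : Set W} {x a : W}
    (ha : a ∈ T) (hxa : x ≠ a) (hna : ¬ H.Adj x a)
    (hdom : ∀ y ∈ T, H.Adj x y → H.Adj a y) (h : OmegaColorableOn H (T \ {x})) :
    OmegaColorableOn H T := by
  classical
  intro k hk
  obtain ⟨c, hc⟩ := h k fun t ht => hk t (ht.trans Set.sdiff_subset)
  have haT : a ∈ T \ {x} := ⟨ha, hxa.symm⟩
  refine ⟨Function.update c x (c a), fun y hy => ?_, fun y hy z hz hyz => ?_⟩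
  · by_cases hyx : y = x
    · subst hyx
      simpa using hc.1 a haT
    · simpa [Function.update_of_ne hyx] using hc.1 y ⟨hy, hyx⟩
  · by_cases hyx : y = x
    · subst hyx
      have hzy : z ≠ y := hyz.ne'
      simpa [Function.update_of_ne hzy] using hc.2 a haT z ⟨hz, hzy⟩ (hdom z hz hyz)
    · by_cases hzx : z = x
      · subst hzx
        simpa [Function.update_of_ne hyx] using
          hc.2 y ⟨hy, hyx⟩ a haT (hdom y hy hyz.symm).symm
      · simpa [Function.update_of_ne hyx, Function.update_of_ne hzx] using
          hc.2 y ⟨hy, hyx⟩ z ⟨hz, hzx⟩ hyz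

/-- The graph obtained from `G` by replacing each vertex by an infinite clique of copies. -/
def replicate {V : Type*} (G : SimpleGraph V) : SimpleGraph (V × ℕ) where
  Adj p q := p ≠ q ∧ (p.1 = q.1 ∨ G.Adj p.1 q.1)
  symm := ⟨fun _ _ h => ⟨h.1.symm, h.2.imp Eq.symm fun h => h.symm⟩⟩
  loopless := ⟨fun _ h => h.1 rfl⟩

/-- Lovász's replication lemma. -/
lemma omegaColorableOn_replicate {V : Type*} {G : SimpleGraph V} {X : Set V}
    (hG : ∀ S ⊆ X, OmegaColorableOn G S) (T : Finset (V × ℕ)) (hT : ∀ p ∈ T, p.1 ∈ X) :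
    OmegaColorableOn (replicate G) T := by
  classical
  induction T using Finset.strongInduction with
  | H T ih =>
  by_cases hinj : Set.InjOn Prod.fst (T : Set (V × ℕ))
  · refine OmegaColorableOn.of_injOn hinj (G := G) (fun p hp q hq => ?_) (hG _ ?_)
    · constructor
      · rintro ⟨hne, h | h⟩
        · exact absurd (hinj hp hq h) hne
        · exact h
      · exact fun h => ⟨fun he => h.ne (by rw [he]), Or.inr h⟩
    · rintro _ ⟨p, hp, rfl⟩
      exact hT p hp
  obtain ⟨p, hp, q, hq, hpq, hne⟩ : ∃ p ∈ T, ∃ q ∈ T, p.1 = q.1 ∧ p ≠ q := by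
    simpa [Set.InjOn, -Prod.forall, -Prod.exists] using hinj
  intro k hk
  have hk0 : 1 ≤ k := by simpa using hk {p} (by simpa using hp) (by simp)
  obtain ⟨c, hc⟩ := ih (T.erase q) (Finset.erase_ssubset hq)
    (fun r hr => hT r (Finset.mem_of_mem_erase hr)) k
    fun t ht => hk t (ht.trans (by simp))
  set T' := (T.erase q).filter fun r => r = p ∨ c r ≠ c p with hT'
  have hT'q : T' ⊆ T.erase q := Finset.filter_subset _ _
  have hbound : CliqueBoundOn (replicate G) T' (k - 1) := by
    intro t ht htc
    have htT : t ⊆ T.erase q := (Finset.coe_subset.1 ht).trans hT'q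
    have hinj := hc.injOn_of_isClique (Finset.coe_subset.2 htT) htc
    by_cases hpt : p ∈ t
    · have hqt : q ∉ t := fun h => by simpa using htT h
      have := hk (insert q t) (by
        intro r hr
        rcases Finset.mem_insert.1 hr with rfl | hr
        · exact hq
        · exact Finset.mem_of_mem_erase (htT hr)) (by
        rw [Finset.coe_insert]
        refine htc.insert fun r hr hqr => ⟨hqr, ?_⟩
        by_cases hrp : r = p
        · exact Or.inl (by rw [hrp, hpq])
        · rw [← hpq]
          exact (htc hpt hr (Ne.symm hrp)).2)
      rw [Finset.card_insert_of_notMem hqt] at this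
      omega
    · have hsub : t.image c ⊆ (Finset.range k).erase (c p) := by
        intro i hi
        obtain ⟨r, hr, rfl⟩ := Finset.mem_image.1 hi
        have h1 := (Finset.mem_filter.1 (ht hr)).2
        have h2 : r ≠ p := fun h => hpt (h ▸ hr)
        simp only [Finset.mem_erase, Finset.mem_range]
        exact ⟨h1.resolve_left h2, hc.1 r (htT hr)⟩
      have := Finset.card_le_card hsub
      rw [Finset.card_image_of_injOn hinj, Finset.card_erase_of_mem
        (Finset.mem_range.2 (hc.1 p (by simp [hp, hne]))), Finset.card_range] at this
      exact this
  obtain ⟨d, hd⟩ := ih T' (hT'q.trans_ssubset (Finset.erase_ssubset hq))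
    (fun r hr => hT r (Finset.mem_of_mem_erase (hT'q hr))) _ hbound
  have hstable : ∀ r ∈ T, ∀ s ∈ T, r ∉ T' → s ∉ T' → ¬ (replicate G).Adj r s := by
    have key : ∀ r ∈ T, r ∉ T' → r ≠ q → r ≠ p ∧ c r = c p := by
      intro r hr hr' hrq
      simpa [hT', hr, hrq, -Prod.forall, -Prod.exists] using hr'
    have hpT : p ∈ T.erase q := by simp [hp, hne]
    have key' : ∀ r ∈ T, r ∉ T' → r ≠ q → ¬ (replicate G).Adj q r := by
      intro r hr hr' hrq hadj
      obtain ⟨h1, h2⟩ := key r hr hr' hrq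
      exact hc.2 p hpT r (by simp [hr, hrq]) ⟨h1.symm, hpq ▸ hadj.2⟩ h2.symm
    intro r hr s hs hr' hs' hadj
    by_cases hrq : r = q
    · subst hrq
      exact key' s hs hs' hadj.ne' hadj
    · by_cases hsq : s = q
      · subst hsq
        exact key' r hr hr' hrq hadj.symm
      · exact hc.2 r (by simp [hr, hrq]) s (by simp [hs, hsq]) hadj
          ((key r hr hr' hrq).2.trans (key s hs hs' hsq).2.symm)
  refine ⟨fun r => if r ∈ T' then d r else k - 1, fun r hr => ?_, fun r hr s hs hadj => ?_⟩
  · by_cases h : r ∈ T'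
    · have := hd.1 r h
      simp only [h, if_true]
      omega
    · simp only [h, if_false]
      omega
  · by_cases h : r ∈ T' <;> by_cases h' : s ∈ T' <;> simp only [h, h', if_true, if_false]
    · exact hd.2 r h s h' hadj
    · exact (hd.1 r h).ne
    · exact (hd.1 s h').ne'
    · exact absurd hadj (hstable r hr s hs h h')

/-- The graph obtained from `G` by adding pairwise nonadjacent vertices with prescribed
neighbourhoods. -/
def attach {V ι : Type*} (G : SimpleGraph V) (N : ι → Set V) : SimpleGraph (V ⊕ ι) where
  Adj
    | .inl x, .inl y => G.Adj x y
    | .inl x, .inr i => x ∈ N i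
    | .inr i, .inl x => x ∈ N i
    | .inr _, .inr _ => False
  symm := ⟨by rintro (x | i) (y | j) h <;> first | exact SimpleGraph.Adj.symm (G := G) h | exact h⟩
  loopless := ⟨by rintro (x | i) h <;> first | exact G.loopless.irrefl _ h | exact h⟩

section attach

variable {V ι : Type*} {G : SimpleGraph V} {N : ι → Set V}

@[simp] lemma attach_adj_inl_inl {x y : V} : (attach G N).Adj (.inl x) (.inl y) ↔ G.Adj x y :=
  Iff.rfl

@[simp] lemma attach_adj_inl_inr {x : V} {i : ι} :
    (attach G N).Adj (.inl x) (.inr i) ↔ x ∈ N i := Iff.rfl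

@[simp] lemma attach_adj_inr_inl {x : V} {i : ι} :
    (attach G N).Adj (.inr i) (.inl x) ↔ x ∈ N i := Iff.rfl

@[simp] lemma not_attach_adj_inr_inr {i j : ι} : ¬ (attach G N).Adj (.inr i) (.inr j) := id

end attach

/-- Let `N true` be complete to `N false`. Suppose each `w i` is a vertex of `G` that, outside
`C` and `N (!i)`, has neighbourhood `N i`. Then attaching to `G - C` nonadjacent vertices with
neighbourhoods `N true` and `N false` preserves perfection. -/
lemma omegaColorableOn_attach {V : Type*} [Finite V] {G : SimpleGraph V}
    (hG : ∀ S ≠ Set.univ, OmegaColorableOn G S) {C : Set V} {N : Bool → Set V} {w : Bool → V}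
    (hN : ∀ i, (N i).Nonempty) (hNC : ∀ i, Disjoint (N i) C)
    (hcomplete : ∀ i, ∀ x ∈ N i, ∀ y ∈ N (!i), G.Adj x y) (hw : ∀ i, w i ∈ C)
    (hadj : ∀ i, ∀ x ∉ C, x ∉ N (!i) → (G.Adj x (w i) ↔ x ∈ N i))
    (T : Finset (V ⊕ Bool)) (hT : ∀ x, Sum.inl x ∈ T → x ∉ C) :
    OmegaColorableOn (attach G N) T := by
  classical
  induction T using Finset.strongInduction with
  | H T ih =>
  have step : ∀ z a, z ∈ T → a ∈ T → z ≠ a → ¬ (attach G N).Adj z a →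
      (∀ y ∈ T, (attach G N).Adj z y → (attach G N).Adj a y) →
      OmegaColorableOn (attach G N) T := by
    intro z a hz ha hza hna hdom
    refine OmegaColorableOn.of_dominated (Finset.mem_coe.2 ha) hza hna hdom ?_
    rw [← Finset.coe_erase]
    exact ih _ (Finset.erase_ssubset hz) fun x hx => hT x (Finset.mem_of_mem_erase hx)
  by_cases hinr : ∃ i, Sum.inr i ∈ T
  swap
  · push Not at hinr
    refine OmegaColorableOn.of_injOn (f := Sum.elim id w) (G := G) ?_ ?_ (hG _ ?_)
    · rintro (x | i) hx (y | j) hy h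
      · simpa using h
      all_goals exact absurd ‹_› (hinr _)
    · rintro (x | i) hx (y | j) hy
      · simp
      all_goals exact absurd ‹_› (hinr _)
    · intro h
      obtain ⟨x | i, hx, hxw⟩ : w true ∈ Sum.elim id w '' (T : Set (V ⊕ Bool)) := h ▸ trivial
      · exact hT x hx ((show x = w true from hxw) ▸ hw true)
      · exact hinr i hx
  obtain ⟨i, hi⟩ := hinr
  by_cases hop : ∃ b ∈ N (!i), Sum.inl b ∈ T
  · obtain ⟨b, hb, hbT⟩ := hop
    refine step (.inr i) (.inl b) hi hbT (by simp) ?_ ?_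
    · intro h
      exact G.loopless.irrefl b (hcomplete i b h b hb)
    · rintro (y | j) hy h
      · exact (hcomplete i y h b hb).symm
      · exact absurd h not_attach_adj_inr_inr
  push Not at hop
  by_cases hni : Sum.inr (!i) ∈ T
  · refine step (.inr (!i)) (.inr i) hni hi (by simp) not_attach_adj_inr_inr ?_
    rintro (y | j) hy h
    · exact absurd hy (hop y h)
    · exact absurd h not_attach_adj_inr_inr
  have hj : ∀ j, Sum.inr j ∈ T → j = i := by
    intro j hj
    by_contra hne
    rw [Bool.eq_not_of_ne hne] at hj
    exact hni hj
  refine OmegaColorableOn.of_injOn (f := Sum.elim id w) (G := G) ?_ ?_ (hG _ ?_)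
  · rintro (x | j) hx (y | l) hy h
    · simpa using h
    · exact absurd (by simpa using (show x = w l from h) ▸ hw l) (hT x hx)
    · exact absurd (by simpa using (show w j = y from h) ▸ hw j) (hT y hy)
    · rw [hj j hx, hj l hy]
  · rintro (x | j) hx (y | l) hy
    · simp
    · obtain rfl := hj l hy
      exact (hadj l x (hT x hx) fun h => hop x h hx).symm
    · obtain rfl := hj j hx
      exact ((G.adj_comm _ _).trans (hadj j y (hT y hy) fun h => hop y h hy)).symm
    · rw [hj j hx, hj l hy]
      simp
  · intro h
    obtain ⟨b, hb⟩ := hN (!i)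
    obtain ⟨x | j, hx, hxb⟩ : b ∈ Sum.elim id w '' (T : Set (V ⊕ Bool)) := h ▸ trivial
    · obtain rfl : x = b := hxb
      exact hop x hb hx
    · exact Set.disjoint_left.1 (hNC (!i)) hb ((show w j = b from hxb) ▸ hw j)

lemma exists_maximum_clique_subset {V : Type*} [Finite V] (G : SimpleGraph V) (A : Set V) :
    ∃ t : Finset V, ↑t ⊆ A ∧ G.IsClique (t : Set V) ∧ CliqueBoundOn G A t.card := by
  classical
  cases nonempty_fintype V
  obtain ⟨t, ht, hmax⟩ := Finset.exists_max_image
    (Finset.univ.filter fun t : Finset V => ↑t ⊆ A ∧ G.IsClique (t : Set V)) Finset.card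
    ⟨∅, by simp⟩
  simp only [Finset.mem_filter, Finset.mem_univ, true_and] at ht hmax
  exact ⟨t, ht.1, ht.2, fun s hs hsc => hmax s ⟨hs, hsc⟩⟩

lemma ProperOn.card_le {V : Type*} {G : SimpleGraph V} {S : Set V} {k : ℕ} {c : V → ℕ}
    (hc : ProperOn G S k c) {t : Finset V} (htS : ↑t ⊆ S) (ht : G.IsClique (t : Set V))
    {I : Finset ℕ} (hI : ∀ x ∈ t, c x ∈ I) : t.card ≤ I.card :=
  Finset.card_le_card_of_injOn c hI (hc.injOn_of_isClique htS ht)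

/-- If there are no edges between `C` and `D`, then every clique of `G` avoids `C` or `D`, so
the cliques inside `X` are bounded by the number of colours appearing on `X` in colourings of
`G - D` and `G - C`. -/
lemma cliqueBoundOn_of_noncrossing {V : Type*} {G : SimpleGraph V} {C D X : Set V} {k : ℕ}
    (hCD : Disjoint C D) (hnadj : ∀ c ∈ C, ∀ d ∈ D, ¬ G.Adj c d) {c₁ c₂ : V → ℕ}
    (h₁ : ProperOn G Dᶜ k c₁) (h₂ : ProperOn G Cᶜ k c₂) {I₁ I₂ : Finset ℕ} {n : ℕ}
    (hI₁ : I₁.card ≤ n) (hI₂ : I₂.card ≤ n) (hX₁ : ∀ x ∈ X, x ∉ D → c₁ x ∈ I₁)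
    (hX₂ : ∀ x ∈ X, x ∉ C → c₂ x ∈ I₂) : CliqueBoundOn G X n := by
  intro t htX ht
  by_cases htD : ∀ x ∈ t, x ∉ D
  · exact (h₁.card_le htD ht fun x hx => hX₁ x (htX hx) (htD x hx)).trans hI₁
  push Not at htD
  obtain ⟨d, hd, hdD⟩ := htD
  have htC : ∀ x ∈ t, x ∉ C := fun x hx hxC =>
    hnadj x hxC d hdD (ht hx hd fun h => Set.disjoint_left.1 hCD hxC (h ▸ hdD))
  exact (h₂.card_le htC ht fun x hx => hX₂ x (htX hx) (htC x hx)).trans hI₂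

lemma ProperOn.union {V : Type*} {G : SimpleGraph V} {X : Set V} {k l : ℕ} {c d : V → ℕ}
    (hc : ProperOn G X k c) (hd : ProperOn G Xᶜ l d) : ∃ e, ProperOn G Set.univ (k + l) e := by
  classical
  refine ⟨fun x => if x ∈ X then c x else k + d x, fun x _ => ?_, fun x _ y _ hxy => ?_⟩
  · by_cases hx : x ∈ X
    · have := hc.1 x hx
      simp only [hx, if_true]
      omega
    · have := hd.1 x hx
      simp only [hx, if_false]
      omega
  · by_cases hx : x ∈ X <;> by_cases hy : y ∈ X <;> simp only [hx, hy, if_true, if_false]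
    · exact hc.2 x hx y hy hxy
    · have := hc.1 x hx
      omega
    · have := hc.1 y hy
      omega
    · have := hd.2 x hx y hy hxy
      omega

/-- In a `U`-cutset, `G - C` has a colouring with `ω(G)` colours that uses only as many colours
on `N true` and on `N false` as the size of their cliques. -/
lemma exists_properOn_economical {V : Type*} [Finite V] {G : SimpleGraph V}
    (hG : ∀ S ≠ Set.univ, OmegaColorableOn G S) {C : Set V} {N : Bool → Set V} {w : Bool → V}
    (hN : ∀ i, (N i).Nonempty) (hNC : ∀ i, Disjoint (N i) C)
    (hcomplete : ∀ i, ∀ x ∈ N i, ∀ y ∈ N (!i), G.Adj x y) (hw : ∀ i, w i ∈ C)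
    (hadj : ∀ i, ∀ x ∉ C, x ∉ N (!i) → (G.Adj x (w i) ↔ x ∈ N i)) {k : ℕ}
    (hk : CliqueBoundOn G Set.univ k) {m : Bool → ℕ} (hm : ∀ i, CliqueBoundOn G (N i) (m i))
    (hmk : ∀ i, m i ≤ k) :
    ∃ c, ProperOn G Cᶜ k c ∧
      ∀ i, ∃ I : Finset ℕ, I.card ≤ m i ∧ ∀ x ∈ N i, c x ∈ I := by
  classical
  cases nonempty_fintype V
  let old : V → (V ⊕ Bool) × ℕ := fun x => (.inl x, 0)
  let new : Bool → ℕ → (V ⊕ Bool) × ℕ := fun i j => (.inr i, j)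
  have hold : Function.Injective old := fun x y h => by simpa [old] using h
  have hnew : ∀ i, Function.Injective (new i) := fun i x y h => by simpa [new] using h
  let T : Finset ((V ⊕ Bool) × ℕ) := (Finset.univ.filter (· ∉ C)).image old ∪
    Finset.univ.biUnion fun i => (Finset.range (k - m i)).image (new i)
  have holdT : ∀ x, old x ∈ T ↔ x ∉ C := by simp [T, old, new]
  have hnewT : ∀ i j, new i j ∈ T ↔ j < k - m i := by
    intro i j
    cases i <;> simp [T, old, new]
  have hT : ∀ p ∈ T, (∃ x ∉ C, old x = p) ∨ ∃ i, ∃ j < k - m i, new i j = p := by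
    intro p hp
    simpa only [T, Finset.mem_union, Finset.mem_image, Finset.mem_biUnion, Finset.mem_filter,
      Finset.mem_univ, true_and, Finset.mem_range] using hp
  have hcol : OmegaColorableOn (replicate (attach G N)) T := by
    refine omegaColorableOn_replicate (X := {p | ∀ x, p = .inl x → x ∉ C}) (fun S hS => ?_) T ?_
    · have := omegaColorableOn_attach hG hN hNC hcomplete hw hadj S.toFinite.toFinset
        fun x hx => hS (by simpa using hx) x rfl
      simpa using this
    · intro p hp x hx
      rcases hT p hp with ⟨y, hy, rfl⟩ | ⟨i, j, -, rfl⟩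
      · simp only [old, Sum.inl.injEq] at hx
        exact hx ▸ hy
      · simp [new] at hx
  have hadj_old : ∀ x y, (replicate (attach G N)).Adj (old x) (old y) ↔ G.Adj x y := by
    intro x y
    refine ⟨fun h => h.2.resolve_left fun he => h.1 (Prod.ext he rfl), fun h => ?_⟩
    exact ⟨hold.ne h.ne, Or.inr h⟩
  have hadj_on : ∀ x i j, (replicate (attach G N)).Adj (old x) (new i j) ↔ x ∈ N i := by
    intro x i j
    simp [replicate, old, new]
  have hadj_new : ∀ i j i' j', (replicate (attach G N)).Adj (new i j) (new i' j') → i = i' := by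
    intro i j i' j' h
    simpa [replicate, new] using h.2
  have hbound : CliqueBoundOn (replicate (attach G N)) T k := by
    intro t htT ht
    let s : Finset V := Finset.univ.filter fun x => old x ∈ t
    have hs : G.IsClique (s : Set V) := by
      intro x hx y hy hxy
      exact (hadj_old x y).1 (ht (by simpa [s] using hx) (by simpa [s] using hy) (hold.ne hxy))
    by_cases hni : ∃ i j, new i j ∈ t
    · obtain ⟨i, j, hij⟩ := hni
      have hsN : (s : Set V) ⊆ N i := by
        intro x hx
        exact (hadj_on x i j).1 (ht (by simpa [s] using hx) hij (by simp [old, new]))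
      have hsub : t ⊆ s.image old ∪ (Finset.range (k - m i)).image (new i) := by
        intro p hp
        rcases hT p (htT hp) with ⟨x, -, rfl⟩ | ⟨i', j', hj', rfl⟩
        · exact Finset.mem_union_left _ (Finset.mem_image_of_mem _ (by simpa [s] using hp))
        · have hii : i' = i := by
            by_contra hne
            exact hne (hadj_new _ _ _ _ (ht hp hij (by simp [new, hne])))
          subst hii
          exact Finset.mem_union_right _ (Finset.mem_image_of_mem _ (by simpa using hj'))
      have h1 := (Finset.card_le_card hsub).trans (Finset.card_union_le _ _)
      rw [Finset.card_image_of_injective _ hold, Finset.card_image_of_injective _ (hnew i),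
        Finset.card_range] at h1
      have h2 := hm i s hsN hs
      have h3 := hmk i
      omega
    · have hsub : t ⊆ s.image old := by
        intro p hp
        rcases hT p (htT hp) with ⟨x, -, rfl⟩ | ⟨i', j', hj', rfl⟩
        · exact Finset.mem_image_of_mem _ (by simpa [s] using hp)
        · exact absurd ⟨i', j', hp⟩ hni
      have h1 := Finset.card_le_card hsub
      rw [Finset.card_image_of_injective _ hold] at h1
      exact h1.trans (hk s (Set.subset_univ _) hs)
  obtain ⟨c, hc⟩ := hcol k hbound
  refine ⟨c ∘ old, ⟨fun x hx => hc.1 _ ((holdT x).2 hx), fun x hx y hy h =>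
    hc.2 _ ((holdT x).2 hx) _ ((holdT y).2 hy) ((hadj_old x y).2 h)⟩, fun i => ?_⟩
  have hinj : Set.InjOn c (((Finset.range (k - m i)).image (new i) : Finset _) : Set _) := by
    refine hc.injOn_of_isClique ?_ ?_
    · intro p hp
      obtain ⟨j, hj, rfl⟩ := Finset.mem_image.1 hp
      exact (hnewT i j).2 (by simpa using hj)
    · intro p hp q hq hpq
      obtain ⟨j, hj, rfl⟩ := Finset.mem_image.1 hp
      obtain ⟨l, hl, rfl⟩ := Finset.mem_image.1 hq
      exact ⟨hpq, Or.inl rfl⟩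
  have hsub : ((Finset.range (k - m i)).image (new i)).image c ⊆ Finset.range k := by
    intro a ha
    obtain ⟨p, hp, rfl⟩ := Finset.mem_image.1 ha
    obtain ⟨j, hj, rfl⟩ := Finset.mem_image.1 hp
    exact Finset.mem_range.2 (hc.1 _ ((hnewT i j).2 (by simpa using hj)))
  refine ⟨Finset.range k \ ((Finset.range (k - m i)).image (new i)).image c, ?_, fun x hx => ?_⟩
  · rw [Finset.card_sdiff_of_subset hsub, Finset.card_image_of_injOn hinj,
      Finset.card_image_of_injective _ (hnew i), Finset.card_range, Finset.card_range]
    have := hmk i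
    omega
  · have hxC := Set.disjoint_left.1 (hNC i) hx
    have hxT := (holdT x).2 hxC
    simp only [Finset.mem_sdiff, Finset.mem_range, Finset.mem_image, not_exists, not_and,
      exists_exists_and_eq_and]
    refine ⟨hc.1 _ hxT, ?_⟩
    rintro j hj
    exact (hc.2 _ hxT _ ((hnewT i j).2 hj) ((hadj_on x i j).2 hx)).symm

/-- No minimally imperfect graph contains a U-cutset: a skew partition
`A, B, C, D` with `u, v ∈ C` such that every vertex of `A` is adjacent to `u` and
every vertex of `B` is adjacent to `v`. -/
theorem no_U_cutset {V : Type*} [Fintype V] (G : SimpleGraph V)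
    (hmi : MinimallyImperfect G) :
    ¬ ∃ (A B C D : Set V) (u v : V), IsSkewPartition G A B C D ∧
      u ∈ C ∧ v ∈ C ∧ (∀ a ∈ A, G.Adj a u) ∧ (∀ b ∈ B, G.Adj b v) := by
    classical
  rintro ⟨A, B, C, D, u, v, ⟨hA, hB, hC, hD, hcover, hAB, hAC, hAD, hBC, hBD, hCD, hadjAB, hadjCD⟩,
    hu, hv, hAu, hBv⟩
  have hG : ∀ S ≠ Set.univ, OmegaColorableOn G S := fun S hS => hmi.omegaColorableOn hS
  have hk := cliqueBoundOn_univ_cliqueNum G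
  have hncol := hmi.not_colorable
  set k := G.cliqueNum
  have hcover' : ∀ x, x ∈ A ∨ x ∈ B ∨ x ∈ C ∨ x ∈ D := by
    intro x
    have : x ∈ A ∪ B ∪ C ∪ D := hcover ▸ trivial
    simpa [or_assoc] using this
  obtain ⟨s, hsA, hs, hsmax⟩ := exists_maximum_clique_subset G A
  obtain ⟨t, htB, ht, htmax⟩ := exists_maximum_clique_subset G B
  obtain ⟨c₂, hc₂, hI⟩ := exists_properOn_economical hG (C := C) (N := fun i => cond i A B)
    (w := fun i => cond i u v) (k := k) (m := fun i => cond i s.card t.card)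
    (by rintro (_ | _) <;> assumption) (by rintro (_ | _) <;> assumption)
    (by
      rintro (_ | _) x hx y hy
      · exact (hadjAB y hy x hx).symm
      · exact hadjAB x hx y hy)
    (by rintro (_ | _) <;> assumption)
    (by
      rintro (_ | _) x hxC hx
      · refine ⟨fun h => ?_, hBv x⟩
        rcases hcover' x with h' | h' | h' | h'
        · exact absurd h' hx
        · exact h'
        · exact absurd h' hxC
        · exact absurd h.symm (hadjCD v hv x h')
      · refine ⟨fun h => ?_, hAu x⟩
        rcases hcover' x with h' | h' | h' | h'
        · exact h'
        · exact absurd h' hx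
        · exact absurd h' hxC
        · exact absurd h.symm (hadjCD u hu x h'))
    hk (by rintro (_ | _) <;> assumption)
    (by
      rintro (_ | _)
      · exact hk t (Set.subset_univ _) ht
      · exact hk s (Set.subset_univ _) hs)
  obtain ⟨I, hIcard, hIA⟩ := hI true
  obtain ⟨J, hJcard, hJB⟩ := hI false
  simp only [cond_true, cond_false] at hIcard hIA hJcard hJB
  obtain ⟨c₁, hc₁⟩ := hG Dᶜ (by
    obtain ⟨d, hd⟩ := hD
    exact fun h => (h ▸ Set.mem_univ d : d ∈ Dᶜ) hd) k fun r _ => hk r (Set.subset_univ _)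
  have hAD' : ∀ x ∈ A, x ∈ Dᶜ := fun x hx => Set.disjoint_left.1 hAD hx
  have hBD' : ∀ x ∈ B, x ∈ Dᶜ := fun x hx => Set.disjoint_left.1 hBD hx
  have hAC' : ∀ x ∈ A, x ∈ Cᶜ := fun x hx => Set.disjoint_left.1 hAC hx
  have hBC' : ∀ x ∈ B, x ∈ Cᶜ := fun x hx => Set.disjoint_left.1 hBC hx
  let I₁ : Finset ℕ := (Finset.univ.filter (· ∈ A)).image c₁
  let J₁ : Finset ℕ := (Finset.univ.filter (· ∈ B)).image c₁
  let I₂ : Finset ℕ := (Finset.univ.filter (· ∈ A)).image c₂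
  let J₂ : Finset ℕ := (Finset.univ.filter (· ∈ B)).image c₂
  have mI₁ : ∀ x ∈ A, c₁ x ∈ I₁ := fun x hx => Finset.mem_image_of_mem _ (by simpa using hx)
  have mJ₁ : ∀ x ∈ B, c₁ x ∈ J₁ := fun x hx => Finset.mem_image_of_mem _ (by simpa using hx)
  have mI₂ : ∀ x ∈ A, c₂ x ∈ I₂ := fun x hx => Finset.mem_image_of_mem _ (by simpa using hx)
  have mJ₂ : ∀ x ∈ B, c₂ x ∈ J₂ := fun x hx => Finset.mem_image_of_mem _ (by simpa using hx)
  have hI₁ : s.card ≤ I₁.card := hc₁.card_le (fun x hx => hAD' x (hsA hx)) hs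
    fun x hx => mI₁ x (hsA hx)
  have hJ₁ : t.card ≤ J₁.card := hc₁.card_le (fun x hx => hBD' x (htB hx)) ht
    fun x hx => mJ₁ x (htB hx)
  have hI₂ : I₂.card ≤ s.card := (Finset.card_le_card (by
    intro a ha
    obtain ⟨x, hx, rfl⟩ := Finset.mem_image.1 ha
    exact hIA x (by simpa using hx))).trans hIcard
  have hJ₂ : J₂.card ≤ t.card := (Finset.card_le_card (by
    intro a ha
    obtain ⟨x, hx, rfl⟩ := Finset.mem_image.1 ha
    exact hJB x (by simpa using hx))).trans hJcard
  have hdisj₁ : Disjoint I₁ J₁ := by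
    rw [Finset.disjoint_left]
    intro a ha hb
    obtain ⟨x, hx, rfl⟩ := Finset.mem_image.1 ha
    obtain ⟨y, hy, hxy⟩ := Finset.mem_image.1 hb
    replace hx : x ∈ A := by simpa using hx
    replace hy : y ∈ B := by simpa using hy
    exact hc₁.2 x (hAD' x hx) y (hBD' y hy) (hadjAB x hx y hy) hxy.symm
  have hdisj₂ : Disjoint I₂ J₂ := by
    rw [Finset.disjoint_left]
    intro a ha hb
    obtain ⟨x, hx, rfl⟩ := Finset.mem_image.1 ha
    obtain ⟨y, hy, hxy⟩ := Finset.mem_image.1 hb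
    replace hx : x ∈ A := by simpa using hx
    replace hy : y ∈ B := by simpa using hy
    exact hc₂.2 x (hAC' x hx) y (hBC' y hy) (hadjAB x hx y hy) hxy.symm
  have hI₁k : I₁ ⊆ Finset.range k := by
    intro a ha
    obtain ⟨x, hx, rfl⟩ := Finset.mem_image.1 ha
    exact Finset.mem_range.2 (hc₁.1 x (hAD' x (by simpa using hx)))
  have hJ₁k : J₁ ⊆ Finset.range k := by
    intro a ha
    obtain ⟨x, hx, rfl⟩ := Finset.mem_image.1 ha
    exact Finset.mem_range.2 (hc₁.1 x (hBD' x (by simpa using hx)))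
  have hI₂k : I₂ ⊆ Finset.range k := by
    intro a ha
    obtain ⟨x, hx, rfl⟩ := Finset.mem_image.1 ha
    exact Finset.mem_range.2 (hc₂.1 x (hAC' x (by simpa using hx)))
  have hJ₂k : J₂ ⊆ Finset.range k := by
    intro a ha
    obtain ⟨x, hx, rfl⟩ := Finset.mem_image.1 ha
    exact Finset.mem_range.2 (hc₂.1 x (hBC' x (by simpa using hx)))
  have hsum : I₁.card + J₁.card ≤ k := by
    simpa [Finset.card_union_of_disjoint hdisj₁] using
      Finset.card_le_card (Finset.union_subset hI₁k hJ₁k)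
  obtain ⟨K, hI₂K, hKsub, hKcard⟩ := Finset.exists_subsuperset_card_eq (n := I₁.card)
    (Finset.subset_sdiff.2 ⟨hI₂k, hdisj₂⟩) (hI₂.trans hI₁) (by
      rw [Finset.card_sdiff_of_subset hJ₂k, Finset.card_range]
      omega)
  have hKk : K ⊆ Finset.range k := hKsub.trans Finset.sdiff_subset
  have hKB : ∀ x ∈ B, c₂ x ∉ K := fun x hx h => (Finset.mem_sdiff.1 (hKsub h)).2 (mJ₂ x hx)
  have hIB : ∀ x ∈ B, c₁ x ∉ I₁ := fun x hx h => Finset.disjoint_left.1 hdisj₁ h (mJ₁ x hx)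
  let X : Set V := {x | (x ∉ D ∧ c₁ x ∈ I₁) ∨ (x ∈ D ∧ c₂ x ∈ K)}
  have hX : CliqueBoundOn G X I₁.card := by
    refine cliqueBoundOn_of_noncrossing hCD hadjCD hc₁ hc₂ le_rfl hKcard.le ?_ ?_
    · rintro x (hx | hx) hxD
      · exact hx.2
      · exact absurd hx.1 hxD
    · rintro x (hx | hx) hxC
      · rcases hcover' x with h | h | h | h
        · exact hI₂K (mI₂ x h)
        · exact absurd hx.2 (hIB x h)
        · exact absurd h hxC
        · exact absurd h hx.1
      · exact hx.2
  have hXc : CliqueBoundOn G Xᶜ (k - I₁.card) := by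
    refine cliqueBoundOn_of_noncrossing hCD hadjCD hc₁ hc₂ (I₁ := Finset.range k \ I₁)
      (I₂ := Finset.range k \ K) ?_ ?_ ?_ ?_
    · rw [Finset.card_sdiff_of_subset hI₁k, Finset.card_range]
    · rw [Finset.card_sdiff_of_subset hKk, Finset.card_range, hKcard]
    · intro x hx hxD
      exact Finset.mem_sdiff.2 ⟨Finset.mem_range.2 (hc₁.1 x hxD),
        fun h => hx (Or.inl ⟨hxD, h⟩)⟩
    · intro x hx hxC
      refine Finset.mem_sdiff.2 ⟨Finset.mem_range.2 (hc₂.1 x hxC), fun h => ?_⟩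
      rcases hcover' x with h' | h' | h' | h'
      · exact hx (Or.inl ⟨hAD' x h', mI₁ x h'⟩)
      · exact hKB x h' h
      · exact hxC h'
      · exact hx (Or.inr ⟨h', h⟩)
  obtain ⟨c, hc⟩ := hG X (by
    obtain ⟨b, hb⟩ := hB
    intro h
    rcases (h ▸ Set.mem_univ b : b ∈ X) with h' | h'
    · exact hIB b hb h'.2
    · exact hKB b hb h'.2) _ hX
  obtain ⟨d, hd⟩ := hG Xᶜ (by
    obtain ⟨a, ha⟩ := hA
    intro h
    exact (h ▸ Set.mem_univ a : a ∈ Xᶜ) (Or.inl ⟨hAD' a ha, mI₁ a ha⟩)) _ hXc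
  refine hncol ?_
  have := hc.union hd
  rwa [Nat.add_sub_cancel' (by omega)] at this
end

section
/- No minimally imperfect graph contains a homogeneous pair. -/
open SimpleGraph

/-- A graph has a homogeneous pair: a partition of the vertices into `A1, A2, B`
with `|A1| + |A2| ≥ 3`, `|B| ≥ 2`, such that every vertex of `B` adjacent to some
vertex of `Ai` is adjacent to all vertices of `Ai` (for `i = 1, 2`). -/
def HasHomogeneousPair {V : Type*} (G : SimpleGraph V) : Prop :=
  ∃ A1 A2 B : Set V,
    A1 ∪ A2 ∪ B = Set.univ ∧
    Disjoint A1 A2 ∧ Disjoint A1 B ∧ Disjoint A2 B ∧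
    3 ≤ A1.ncard + A2.ncard ∧ 2 ≤ B.ncard ∧
    (∀ b ∈ B, (∃ a ∈ A1, G.Adj b a) → ∀ a ∈ A1, G.Adj b a) ∧
    (∀ b ∈ B, (∃ a ∈ A2, G.Adj b a) → ∀ a ∈ A2, G.Adj b a)

/-- `c` assigns to each vertex `v` a set of `w v` colors among `0, …, n - 1`, with adjacent vertices
receiving disjoint sets. -/
structure IsMulticoloring {V : Type*} (G : SimpleGraph V) (w : V → ℕ) (n : ℕ)
    (c : V → Finset ℕ) : Prop where
  subset_range : ∀ v, c v ⊆ Finset.range n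
  card_eq : ∀ v, (c v).card = w v
  disjoint : ∀ u v, G.Adj u v → Disjoint (c u) (c v)

/-- Every clique has weight at most `n`. -/
def CliqueBound {V : Type*} (G : SimpleGraph V) (w : V → ℕ) (n : ℕ) : Prop :=
  ∀ K : Finset V, G.IsClique (K : Set V) → ∑ v ∈ K, w v ≤ n

/-- Weighted perfection: every weight supported on `s` has a multicoloring with as many colors as
the weight of a heaviest clique. -/
def WeightPerfectOn {V : Type*} (G : SimpleGraph V) (s : Set V) : Prop :=
  ∀ w : V → ℕ, (∀ v, v ∉ s → w v = 0) → ∀ n, CliqueBound G w n → ∃ c, IsMulticoloring G w n c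

/-- A stable set of vertices. -/
def IsStable {V : Type*} (G : SimpleGraph V) (S : Set V) : Prop :=
  ∀ u ∈ S, ∀ v ∈ S, ¬ G.Adj u v

section Multicoloring

variable {V : Type*} {G : SimpleGraph V} {w : V → ℕ} {n : ℕ} {c : V → Finset ℕ}

lemma IsMulticoloring.isStable (h : IsMulticoloring G w n c) (i : ℕ) :
    IsStable G {v | i ∈ c v} := fun u hu v hv huv =>
  Finset.disjoint_left.1 (h.disjoint u v huv) hu hv

lemma IsMulticoloring.not_mem_of_adj (h : IsMulticoloring G w n c) {i : ℕ} {u v : V}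
    (huv : G.Adj u v) (hu : i ∈ c u) : i ∉ c v :=
  Finset.disjoint_left.1 (h.disjoint u v huv) hu

lemma IsMulticoloring.lt (h : IsMulticoloring G w n c) {i : ℕ} {v : V} (hi : i ∈ c v) : i < n :=
  Finset.mem_range.1 (h.subset_range v hi)

lemma IsMulticoloring.exists_mem (h : IsMulticoloring G w n c) {v : V} (hv : 0 < w v) :
    ∃ i, i ∈ c v := by
  rw [← h.card_eq v] at hv
  exact Finset.card_pos.1 hv

/-- In a tight multicoloring, every color class meets every heaviest clique. -/
lemma IsMulticoloring.hits (h : IsMulticoloring G w n c) {K : Finset V}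
    (hK : G.IsClique (K : Set V)) (hn : n ≤ ∑ v ∈ K, w v) {i : ℕ} (hi : i < n) :
    ∃ v ∈ K, i ∈ c v := by
  classical
  have hcard : (K.biUnion c).card = ∑ v ∈ K, w v := by
    rw [Finset.card_biUnion]
    · exact Finset.sum_congr rfl fun v _ => h.card_eq v
    · exact fun u hu v hv huv => h.disjoint u v (hK hu hv huv)
  have hsub : K.biUnion c ⊆ Finset.range n :=
    Finset.biUnion_subset.2 fun v _ => h.subset_range v
  have heq := Finset.eq_of_subset_of_card_le hsub (by rw [Finset.card_range, hcard]; exact hn)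
  have : i ∈ K.biUnion c := by rw [heq]; exact Finset.mem_range.2 hi
  simpa using this

/-- Adding a new color on a stable set. -/
lemma IsMulticoloring.exists_add_stable {w' : V → ℕ} (h : IsMulticoloring G w n c) {S : Set V}
    (hS : IsStable G S) (h1 : ∀ v ∈ S, w' v = w v + 1) (h0 : ∀ v ∉ S, w' v = w v) :
    ∃ c', IsMulticoloring G w' (n + 1) c' := by
  classical
  have hn : ∀ v, n ∉ c v := fun v hv => lt_irrefl _ (h.lt hv)
  refine ⟨fun v => if v ∈ S then insert n (c v) else c v, ?_, ?_, ?_⟩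
  · intro v i hi
    have : i = n ∨ i ∈ c v := by
      split_ifs at hi
      · simpa using hi
      · exact Or.inr hi
    rcases this with rfl | hi
    · simp
    · exact Finset.mem_range.2 ((h.lt hi).trans (Nat.lt_succ_self n))
  · intro v
    by_cases hv : v ∈ S
    · simp [hv, hn, h1, h.card_eq]
    · simp [hv, h0, h.card_eq]
  · intro u v huv
    have hd := h.disjoint u v huv
    by_cases hu : u ∈ S <;> by_cases hv : v ∈ S
    · exact absurd huv (hS u hu v hv)
    all_goals simp [hu, hv, hn, hd]

lemma sum_add_one_le_of_hits {w' : V → ℕ} {K : Finset V} {S : Set V}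
    (h1 : ∀ v ∈ S, w v = w' v + 1) (h0 : ∀ v ∉ S, w v = w' v) (hK : ∃ v ∈ K, v ∈ S) :
    ∑ v ∈ K, w' v + 1 ≤ ∑ v ∈ K, w v := by
  obtain ⟨v, hvK, hvS⟩ := hK
  refine Nat.succ_le_of_lt (Finset.sum_lt_sum (fun u _ => ?_) ⟨v, hvK, ?_⟩)
  swap
  · rw [h1 v hvS]; exact Nat.lt_succ_self _
  by_cases hu : u ∈ S
  · rw [h1 u hu]; omega
  · rw [h0 u hu]

/-- Lovász's replication lemma: for weighted perfection it suffices to consider weights `0, 1`. -/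
lemma weightPerfectOn_of_le_one [Fintype V] {s : Set V}
    (h : ∀ w : V → ℕ, (∀ v, w v ≤ 1) → (∀ v, v ∉ s → w v = 0) → ∀ n, CliqueBound G w n →
      ∃ c, IsMulticoloring G w n c) : WeightPerfectOn G s := by
  classical
  intro w
  induction hk : ∑ v, w v using Nat.strong_induction_on generalizing w with
  | _ k ih =>
  intro hs n hn
  by_cases hw : ∀ v, w v ≤ 1
  · exact h w hw hs n hn
  push Not at hw
  obtain ⟨v, hv⟩ := hw
  have hvn : w v ≤ n := by simpa using hn {v} (by simp)
  obtain ⟨m, rfl⟩ : ∃ m, n = m + 1 := ⟨n - 1, by omega⟩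
  set u : V → ℕ := Function.update w v (w v - 1) with hu
  have hu1 : ∀ x ∈ ({v} : Set V), w x = u x + 1 := by
    rintro x rfl
    simp only [hu, Function.update_self]; omega
  have hu0 : ∀ x ∉ ({v} : Set V), w x = u x := by
    intro x hx
    simp only [hu]
    rw [Function.update_of_ne hx]
  have hule : ∀ x, u x ≤ w x := fun x => by
    by_cases hx : x ∈ ({v} : Set V)
    · rw [hu1 x hx]; omega
    · rw [hu0 x hx]
  have hulast := sum_add_one_le_of_hits (K := Finset.univ) hu1 hu0 ⟨v, by simp, rfl⟩
  obtain ⟨c, hc⟩ := ih (∑ x, u x) (by omega) u rfl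
    (fun x hx => Nat.le_zero.1 ((hule x).trans (hs x hx).le)) (m + 1)
    (fun K hK => (Finset.sum_le_sum fun x _ => hule x).trans (hn K hK))
  obtain ⟨i, hi⟩ := hc.exists_mem (v := v) (by have := hu1 v rfl; omega)
  have hpos : ∀ x, i ∈ c x → 0 < w x := fun x hx =>
    lt_of_lt_of_le (by rw [← hc.card_eq x]; exact Finset.card_pos.2 ⟨i, hx⟩) (hule x)
  set w' : V → ℕ := fun x => if i ∈ c x then w x - 1 else w x with hw'
  have hw1 : ∀ x ∈ {x | i ∈ c x}, w x = w' x + 1 := fun x (hx : i ∈ c x) => by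
    have := hpos x hx
    simp only [hw', hx, if_true]; omega
  have hw0 : ∀ x ∉ {x | i ∈ c x}, w x = w' x := fun x (hx : i ∉ c x) => by
    simp only [hw', hx, if_false]
  have hlast := sum_add_one_le_of_hits (K := Finset.univ) hw1 hw0 ⟨v, by simp, hi⟩
  have hle : ∀ x, w' x ≤ w x := fun x => by
    by_cases hx : i ∈ c x
    · rw [hw1 x hx]; omega
    · rw [hw0 x hx]
  obtain ⟨c', hc'⟩ := ih (∑ x, w' x) (by omega) w' rfl
    (fun x hx => Nat.le_zero.1 ((hle x).trans (hs x hx).le)) m (fun K hK => by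
      by_cases hit : ∃ x ∈ K, i ∈ c x
      · have := sum_add_one_le_of_hits hw1 hw0 hit
        have := hn K hK
        omega
      · have hvK : v ∉ K := fun hvK => hit ⟨v, hvK, hi⟩
        have h2 : ∑ x ∈ K, u x = ∑ x ∈ K, w x := Finset.sum_congr rfl fun x hx =>
          (hu0 x fun hxv => hvK (by rwa [Set.mem_singleton_iff.1 hxv] at hx)).symm
        have h3 : ∑ x ∈ K, w' x ≤ ∑ x ∈ K, w x := Finset.sum_le_sum fun x _ => hle x
        by_contra hcon
        exact hit (hc.hits hK (by omega) (hc.lt hi)))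
  exact hc'.exists_add_stable (hc.isStable i) hw1 hw0

end Multicoloring

section PerfectGraphTheorem

variable {V : Type*} [Fintype V] {G : SimpleGraph V}

omit [Fintype V] in
lemma isStable_of_isClique_compl {S : Set V} (h : Gᶜ.IsClique S) : IsStable G S :=
  fun u hu v hv huv => ((G.compl_adj u v).1 (h hu hv huv.ne)).2 huv

omit [Fintype V] in
lemma IsStable.isClique_compl {S : Set V} (h : IsStable G S) : Gᶜ.IsClique S :=
  fun u hu v hv huv => (G.compl_adj u v).2 ⟨huv, h u hu v hv⟩

omit [Fintype V] in
lemma card_inter_le_one {S : Set V} (hS : IsStable G S) {K : Finset V}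
    (hK : G.IsClique (K : Set V)) [DecidablePred (· ∈ S)] :
    (K.filter (· ∈ S)).card ≤ 1 := by
  refine Finset.card_le_one.2 fun u hu v hv => ?_
  simp only [Finset.mem_filter] at hu hv
  by_contra huv
  exact hS u hu.2 v hv.2 (hK hu.1 hv.1 huv)

/-- A weight-perfect graph has a clique meeting all largest stable sets. -/
lemma WeightPerfectOn.exists_clique_meeting {s : Set V} (h : WeightPerfectOn G s) {T : Set V}
    (hT : T ⊆ s) {n : ℕ} (hn0 : 0 < n) (hn : ∀ S : Finset V, (S : Set V) ⊆ T → IsStable G (S : Set V) →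
      S.card ≤ n) :
    ∃ K : Finset V, (K : Set V) ⊆ T ∧ G.IsClique (K : Set V) ∧
      ∀ S : Finset V, (S : Set V) ⊆ T → IsStable G (S : Set V) → S.card = n →
        ∃ v ∈ K, v ∈ S := by
  classical
  by_contra! hcon
  have hne : ∀ K : Finset V, ∃ S : Finset V, (K : Set V) ⊆ T → G.IsClique (K : Set V) →
      ((S : Set V) ⊆ T ∧ IsStable G (S : Set V) ∧ S.card = n ∧ ∀ v ∈ K, v ∉ S) := fun K => by
    by_cases hK : (K : Set V) ⊆ T ∧ G.IsClique (K : Set V)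
    · obtain ⟨S, hS⟩ := hcon K hK.1 hK.2
      exact ⟨S, fun _ _ => hS⟩
    · exact ⟨∅, fun h1 h2 => absurd ⟨h1, h2⟩ hK⟩
  choose F hF using hne
  set 𝒦 : Finset (Finset V) :=
    Finset.univ.filter fun K : Finset V => (K : Set V) ⊆ T ∧ G.IsClique (K : Set V) with h𝒦
  have hF' : ∀ K ∈ 𝒦, ((F K : Set V) ⊆ T ∧ IsStable G (F K : Set V) ∧ (F K).card = n ∧
      ∀ v ∈ K, v ∉ F K) := fun K hK => by
    simp only [h𝒦, Finset.mem_filter, Finset.mem_univ, true_and] at hK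
    exact hF K hK.1 hK.2
  have hempty : ∅ ∈ 𝒦 := by simp [h𝒦]
  obtain ⟨N, hN⟩ : ∃ N, 𝒦.card = N + 1 :=
    ⟨𝒦.card - 1, by have := Finset.card_pos.2 ⟨_, hempty⟩; omega⟩
  set w : V → ℕ := fun v => (𝒦.filter fun K => v ∈ F K).card with hw
  have hsum : ∀ L : Finset V, ∑ v ∈ L, w v = ∑ K ∈ 𝒦, (L.filter (· ∈ F K)).card := fun L => by
    simp only [hw, Finset.card_filter]
    exact Finset.sum_comm
  have hws : ∀ v, v ∉ T → w v = 0 := fun v hv => by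
    simp only [hw, Finset.card_eq_zero, Finset.filter_eq_empty_iff]
    exact fun K hK hvK => hv ((hF' K hK).1 hvK)
  obtain ⟨c, hc⟩ := h w (fun v hv => hws v fun hvT => hv (hT hvT)) N (fun L hL => by
    have hLT : L.filter (· ∈ T) ∈ 𝒦 := by
      simp only [h𝒦, Finset.mem_filter, Finset.mem_univ, true_and]
      refine ⟨fun v hv => (Finset.mem_filter.1 hv).2, hL.subset fun v hv => ?_⟩
      exact (Finset.mem_filter.1 hv).1
    rw [hsum, ← Nat.lt_succ_iff, Nat.succ_eq_add_one, ← hN, Finset.card_eq_sum_ones]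
    refine Finset.sum_lt_sum (fun K hK => card_inter_le_one (hF' K hK).2.1 hL)
      ⟨_, hLT, ?_⟩
    rw [Nat.lt_one_iff, Finset.card_eq_zero, Finset.filter_eq_empty_iff]
    exact fun v hv hvF => (hF' _ hLT).2.2.2 v
      (Finset.mem_filter.2 ⟨hv, (hF' _ hLT).1 hvF⟩) hvF)
  have htot : ∑ v, w v = (N + 1) * n := by
    rw [hsum, Finset.sum_congr rfl (g := fun _ => n), Finset.sum_const, hN, smul_eq_mul]
    intro K hK
    rw [Finset.filter_univ_mem]
    exact (hF' K hK).2.2.1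
  have hle : ∑ v, w v ≤ N * n := by
    calc ∑ v, w v = ∑ v, ∑ i ∈ Finset.range N, if i ∈ c v then 1 else 0 := by
          refine Finset.sum_congr rfl fun v _ => ?_
          rw [← Finset.card_filter, Finset.filter_mem_eq_inter,
            Finset.inter_eq_right.2 (hc.subset_range v), hc.card_eq]
      _ = ∑ i ∈ Finset.range N, (Finset.univ.filter fun v => i ∈ c v).card := by
          rw [Finset.sum_comm]
          simp only [Finset.card_filter]
      _ ≤ ∑ i ∈ Finset.range N, n := by
          refine Finset.sum_le_sum fun i _ => hn _ ?_ ?_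
          · intro v hv
            by_contra hvT
            have hi : i ∈ c v := by simpa using hv
            have : c v = ∅ := Finset.card_eq_zero.1 (by rw [hc.card_eq, hws v hvT])
            simp [this] at hi
          · intro u hu v hv
            exact hc.isStable i u (by simpa using hu) v (by simpa using hv)
      _ = N * n := by simp
  rw [htot] at hle
  nlinarith

/-- The weak perfect graph theorem, in weighted form. -/
lemma WeightPerfectOn.compl {s : Set V} (h : WeightPerfectOn G s) : WeightPerfectOn Gᶜ s := by
  classical
  refine weightPerfectOn_of_le_one fun w hw hs n => ?_
  induction n generalizing w with
  | zero =>
    intro hb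
    refine ⟨fun _ => ∅, by simp, fun v => ?_, by simp⟩
    have : w v ≤ 0 := by simpa using hb {v} (by simp)
    simp; omega
  | succ n ih =>
    intro hb
    have hone : ∀ v, w v ≠ 0 → w v = 1 := fun v hv => by have := hw v; omega
    have hsum : ∀ S : Finset V, (S : Set V) ⊆ {v | w v ≠ 0} → ∑ v ∈ S, w v = S.card :=
      fun S hS => by
        rw [Finset.card_eq_sum_ones]
        exact Finset.sum_congr rfl fun v hv => hone v (hS hv)
    obtain ⟨K, hKT, hK, hmeet⟩ := h.exists_clique_meeting (T := {v | w v ≠ 0}) (n := n + 1)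
      (fun v hv => by by_contra hvs; exact hv (hs v hvs)) n.succ_pos
      (fun S hS hst => by rw [← hsum S hS]; exact hb S hst.isClique_compl)
    have h1 : ∀ v ∈ (K : Set V), w v = (if v ∈ K then 0 else w v) + 1 := fun v hv => by
      rw [hone v (hKT hv), if_pos (Finset.mem_coe.1 hv)]
    have h0 : ∀ v ∉ (K : Set V), w v = if v ∈ K then 0 else w v := fun v hv => by
      rw [if_neg (fun h => hv (Finset.mem_coe.2 h))]
    obtain ⟨c, hc⟩ := ih (fun v => if v ∈ K then 0 else w v)
      (fun v => by split_ifs; exacts [zero_le_one, hw v])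
      (fun v hv => by simp [hs v hv]) (fun S hS => by
        by_cases hit : ∃ v ∈ S, v ∈ (K : Set V)
        · have := sum_add_one_le_of_hits h1 h0 hit
          exact Nat.le_of_succ_le_succ (this.trans (hb S hS))
        · push Not at hit
          rw [Finset.sum_congr rfl fun v hv => (h0 v (hit v hv)).symm]
          by_contra hlt
          have heq : ∑ v ∈ S, w v = n + 1 := le_antisymm (hb S hS) (Nat.lt_of_not_le hlt)
          set S' := S.filter fun v => w v ≠ 0
          have hS'T : (S' : Set V) ⊆ {v | w v ≠ 0} := fun v hv => (Finset.mem_filter.1 hv).2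
          have hS' : S'.card = n + 1 := by
            rw [← hsum S' hS'T, Finset.sum_filter_ne_zero, heq]
          obtain ⟨v, hvK, hvS⟩ := hmeet S' hS'T (isStable_of_isClique_compl
            (hS.subset fun v hv => (Finset.mem_filter.1 hv).1)) hS'
          exact hit v (Finset.mem_filter.1 hvS).1 hvK)
    refine hc.exists_add_stable (S := (K : Set V)) (fun u hu v hv huv => ?_) h1 h0
    exact ((G.compl_adj u v).1 huv).2 (hK hu hv huv.ne)

end PerfectGraphTheorem

section Critical

variable {V : Type*} [Fintype V] {G : SimpleGraph V} {n : ℕ}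

omit [Fintype V] in
lemma IsPerfect.exists_isMulticoloring {s : Set V} (h : IsPerfect (G.induce s)) {w : V → ℕ}
    (hw : ∀ v, w v ≤ 1) (hs : ∀ v, v ∈ s ↔ w v ≠ 0) (hb : CliqueBound G w n) :
    ∃ c, IsMulticoloring G w n c := by
  classical
  have hone : ∀ v ∈ s, w v = 1 := fun v hv => by have := hw v; have := (hs v).1 hv; omega
  set H := (G.induce s).induce Set.univ with hH
  have hbound : H.cliqueNum ≤ n := by
    obtain ⟨K, hK⟩ := H.exists_isNClique_cliqueNum
    rw [← hK.card_eq]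
    set f : (Set.univ : Set s) ↪ V :=
      (Function.Embedding.subtype _).trans (Function.Embedding.subtype _) with hf
    have hsum : ∑ v ∈ K.map f, w v = K.card := by
      rw [Finset.sum_map, Finset.card_eq_sum_ones]
      exact Finset.sum_congr rfl fun v _ => hone _ v.1.2
    rw [← hsum]
    refine hb _ ?_
    rw [Finset.coe_map]
    rintro _ ⟨u, hu, rfl⟩ _ ⟨v, hv, rfl⟩ huv
    exact hK.isClique hu hv fun h => huv (by rw [h])
  have hcol : H.Colorable n := by
    rw [← chromaticNumber_le_iff_colorable, ← h Set.univ]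
    exact_mod_cast hbound
  obtain ⟨C⟩ := hcol
  refine ⟨fun v => if hv : v ∈ s then {(C ⟨⟨v, hv⟩, trivial⟩ : ℕ)} else ∅, ?_, ?_, ?_⟩
  · intro v
    by_cases hv : v ∈ s <;> simp [hv]
  · intro v
    by_cases hv : v ∈ s
    · simp [hv, hone v hv]
    · have : w v = 0 := by by_contra h0; exact hv ((hs v).2 h0)
      simp [hv, this]
  · intro u v huv
    by_cases hu : u ∈ s <;> by_cases hv : v ∈ s <;> simp only [hu, hv, dif_pos, dif_neg,
      not_false_eq_true, Finset.disjoint_empty_left, Finset.disjoint_empty_right]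
    rw [Finset.disjoint_singleton]
    intro heq
    exact C.valid (v := ⟨⟨u, hu⟩, trivial⟩) (w := ⟨⟨v, hv⟩, trivial⟩) huv (Fin.ext heq)

omit [Fintype V] in
lemma WeightPerfectOn.mono {s t : Set V} (h : WeightPerfectOn G t) (hst : s ⊆ t) :
    WeightPerfectOn G s :=
  fun w hw => h w fun v hv => hw v fun hvs => hv (hst hvs)

lemma WeightPerfectOn.cliqueNum_eq {s : Set V} (h : WeightPerfectOn G s) :
    ((G.induce s).cliqueNum : ℕ∞) = (G.induce s).chromaticNumber := by
  classical
  refine le_antisymm (G.induce s).cliqueNum_le_chromaticNumber ?_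
  obtain ⟨c, hc⟩ := h (fun v => if v ∈ s then 1 else 0) (fun v hv => by simp [hv])
    (G.induce s).cliqueNum (fun K hK => by
      rw [← Finset.card_filter]
      have hcl : (G.induce s).IsClique ((K.subtype (· ∈ s) : Finset s) : Set s) := by
        intro u hu v hv huv
        simp only [Finset.mem_coe, Finset.mem_subtype] at hu hv
        exact hK hu hv fun h => huv (Subtype.ext h)
      rw [← Finset.card_subtype]
      exact hcl.card_le_cliqueNum)
  rw [chromaticNumber_le_iff_colorable]
  have hmem : ∀ v : s, ∃ i, i ∈ c v := fun v => hc.exists_mem (by simp)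
  choose f hf using hmem
  refine ⟨Coloring.mk (fun v => ⟨f v, hc.lt (hf v)⟩) fun {u v} huv heq => ?_⟩
  have hfe : f u = f v := congrArg Fin.val heq
  exact hc.not_mem_of_adj huv (hf u) (hfe ▸ hf v)

/-- A graph all of whose proper induced subgraphs are weight-perfect, whose cliques have at most
`n` vertices, but which is not `n`-colorable. -/
structure IsCritical (G : SimpleGraph V) (n : ℕ) : Prop where
  proper : ∀ s : Set V, s ≠ Set.univ → WeightPerfectOn G s
  bound : ∀ K : Finset V, G.IsClique (K : Set V) → K.card ≤ n
  not_colorable : ¬ ∃ c, IsMulticoloring G (fun _ => 1) n c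

lemma exists_isCritical (hp : ∀ s : Set V, s ≠ Set.univ → WeightPerfectOn G s)
    (hu : ¬ WeightPerfectOn G Set.univ) : ∃ n, IsCritical G n := by
  by_contra! hcon
  refine hu (weightPerfectOn_of_le_one fun w hw _ n hb => ?_)
  by_cases hs : {v | w v ≠ 0} = Set.univ
  · have hone : w = fun _ => 1 := funext fun v => by
      have h1 : w v ≠ 0 := (Set.ext_iff.1 hs v).2 trivial
      have := hw v
      omega
    subst hone
    by_contra hc
    exact hcon n ⟨hp, fun K hK => by simpa using hb K hK, hc⟩
  · exact hp _ hs w (fun v hv => by simpa using hv) n hb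

omit [Fintype V] in
lemma IsCritical.not_weightPerfectOn (h : IsCritical G n) : ¬ WeightPerfectOn G Set.univ :=
  fun hu => h.not_colorable (hu _ (by simp) n fun K hK => by simpa using h.bound K hK)

lemma IsCritical.exists_compl (h : IsCritical G n) : ∃ m, IsCritical Gᶜ m :=
  exists_isCritical (fun s hs => (h.proper s hs).compl) fun hu => h.not_weightPerfectOn
    (by simpa using hu.compl)

lemma MinimallyImperfect.exists_isCritical (h : MinimallyImperfect G) : ∃ n, IsCritical G n := by
  refine _root_.exists_isCritical (fun s hs => weightPerfectOn_of_le_one fun w hw hws n hb => ?_)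
    fun hu => h.1 fun s => (hu.mono (Set.subset_univ s)).cliqueNum_eq
  refine (h.2 {v | w v ≠ 0} fun heq => hs ?_).exists_isMulticoloring hw (fun v => Iff.rfl) hb
  refine Set.eq_univ_of_forall fun v => ?_
  by_contra hv
  exact (Set.ext_iff.1 heq v).2 trivial (hws v hv)

/-- No nonempty stable set of a critical graph meets all largest cliques. -/
lemma IsCritical.exists_clique_avoiding (h : IsCritical G n) {S : Set V} (hS : IsStable G S)
    (hne : S.Nonempty) :
    ∃ K : Finset V, G.IsClique (K : Set V) ∧ K.card = n ∧ ∀ v ∈ K, v ∉ S := by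
  classical
  by_contra! hcon
  obtain ⟨x, hx⟩ := hne
  have hn : 1 ≤ n := by simpa using h.bound {x} (by simp)
  obtain ⟨m, rfl⟩ : ∃ m, n = m + 1 := ⟨n - 1, by omega⟩
  have h1 : ∀ v ∈ S, 1 = (if v ∈ S then 0 else 1) + 1 := fun v hv => by simp [hv]
  have h0 : ∀ v ∉ S, 1 = if v ∈ S then 0 else 1 := fun v hv => by simp [hv]
  obtain ⟨c, hc⟩ := h.proper Sᶜ (fun heq => (Set.ext_iff.1 heq x).2 trivial hx)
    (fun v => if v ∈ S then 0 else 1) (fun v hv => by simpa using hv) m (fun K hK => by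
      have hb := h.bound K hK
      rw [Finset.card_eq_sum_ones] at hb
      by_cases hit : ∃ v ∈ K, v ∈ S
      · exact Nat.le_of_succ_le_succ ((sum_add_one_le_of_hits h1 h0 hit).trans hb)
      · push Not at hit
        rw [Finset.sum_congr rfl fun v hv => (h0 v (hit v hv)).symm]
        by_contra hlt
        obtain ⟨v, hv, hvS⟩ := hcon K hK (by rw [Finset.card_eq_sum_ones]; omega)
        exact hit v hv hvS)
  exact h.not_colorable (hc.exists_add_stable hS h1 h0)

omit [Fintype V] in
lemma IsCritical.card_add_card_le (h : IsCritical G n) {L M : Finset V}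
    (hL : G.IsClique (L : Set V)) (hM : G.IsClique (M : Set V))
    (hLM : ∀ u ∈ M, ∀ v ∈ L, G.Adj u v) : L.card + M.card ≤ n := by
  classical
  rw [← Finset.card_union_of_disjoint
    (Finset.disjoint_left.2 fun u hu hv => (hLM u hv u hu).ne rfl)]
  refine h.bound _ ?_
  rw [Finset.coe_union]
  rintro u (hu | hu) v (hv | hv) huv
  exacts [hL hu hv huv, (hLM v hv u hu).symm, hLM u hu v hv, hM hu hv huv]

omit [Fintype V] in
/-- Multicoloring a set `P` of vertices together with multiples of two further vertices. -/
lemma IsCritical.exists_multicoloring_two_points (h : IsCritical G n) {P : Set V} {x y : V}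
    (hx : x ∉ P) (hy : y ∉ P) (hxy : x ≠ y) {d e N : ℕ}
    (hv : ∃ v, v ∉ P ∧ (v = x → d = 0) ∧ (v = y → e = 0))
    (hP : ∀ M : Finset V, G.IsClique (M : Set V) → (M : Set V) ⊆ P → M.card ≤ N)
    (hPx : ∀ M : Finset V, G.IsClique (M : Set V) → (M : Set V) ⊆ P →
      (∀ u ∈ M, G.Adj u x) → M.card + d ≤ N)
    (hPy : ∀ M : Finset V, G.IsClique (M : Set V) → (M : Set V) ⊆ P →
      (∀ u ∈ M, G.Adj u y) → M.card + e ≤ N)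
    (hPxy : G.Adj x y → ∀ M : Finset V, G.IsClique (M : Set V) → (M : Set V) ⊆ P →
      (∀ u ∈ M, G.Adj u x) → (∀ u ∈ M, G.Adj u y) → M.card + d + e ≤ N) :
    ∃ (w : V → ℕ) (c : V → Finset ℕ), IsMulticoloring G w N c ∧ (c x).card = d ∧
      (c y).card = e ∧
      (∀ i < N, ∀ M : Finset V, G.IsClique (M : Set V) → (M : Set V) ⊆ P → N ≤ M.card →
        ∃ v ∈ M, i ∈ c v) ∧
      (∀ i < N, ∀ M : Finset V, G.IsClique (M : Set V) → (M : Set V) ⊆ P →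
        (∀ u ∈ M, G.Adj u x) → N ≤ M.card + d → i ∈ c x ∨ ∃ v ∈ M, i ∈ c v) ∧
      (∀ i < N, ∀ M : Finset V, G.IsClique (M : Set V) → (M : Set V) ⊆ P →
        (∀ u ∈ M, G.Adj u y) → N ≤ M.card + e → i ∈ c y ∨ ∃ v ∈ M, i ∈ c v) := by
  classical
  set w : V → ℕ := fun v =>
    (if v ∈ P then 1 else 0) + (if v = x then d else 0) + (if v = y then e else 0) with hw
  have hsum : ∀ K : Finset V, ∑ v ∈ K, w v = (K.filter (· ∈ P)).card +
      (if x ∈ K then d else 0) + (if y ∈ K then e else 0) := fun K => by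
    simp only [hw, Finset.sum_add_distrib, Finset.sum_ite_eq', ← Finset.card_filter]
  obtain ⟨v₀, hv₀P, hv₀x, hv₀y⟩ := hv
  have hw₀ : w v₀ = 0 := by
    simp only [hw, hv₀P, if_false]
    split_ifs with h1 h2 h2 <;> simp_all
  obtain ⟨c, hc⟩ := h.proper {v₀}ᶜ (fun heq => (Set.ext_iff.1 heq v₀).2 trivial rfl) w
    (fun v hv => by
      have : v = v₀ := by simpa using hv
      rw [this, hw₀]) N (fun K hK => by
      rw [hsum]
      have hf : G.IsClique ((K.filter (· ∈ P) : Finset V) : Set V) :=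
        hK.subset fun v hv => (Finset.mem_filter.1 hv).1
      have hfP : ((K.filter (· ∈ P) : Finset V) : Set V) ⊆ P :=
        fun v hv => (Finset.mem_filter.1 hv).2
      have hadj : ∀ z ∈ K, z ∉ P → ∀ u ∈ K.filter (· ∈ P), G.Adj u z := fun z hz hzP u hu =>
        hK (Finset.mem_filter.1 hu).1 hz fun h => hzP (h ▸ (Finset.mem_filter.1 hu).2)
      by_cases hxK : x ∈ K <;> by_cases hyK : y ∈ K
      · simpa [hxK, hyK] using hPxy (hK hxK hyK hxy) _ hf hfP (hadj x hxK hx) (hadj y hyK hy)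
      · simpa [hxK, hyK] using hPx _ hf hfP (hadj x hxK hx)
      · simpa [hxK, hyK] using hPy _ hf hfP (hadj y hyK hy)
      · simpa [hxK, hyK] using hP _ hf hfP)
  have hfilter : ∀ M : Finset V, (M : Set V) ⊆ P → M.filter (· ∈ P) = M := fun M hM =>
    Finset.filter_true_of_mem fun v hv => hM hv
  have hext : ∀ z ∉ P, ∀ i < N, ∀ M : Finset V, G.IsClique (M : Set V) → (M : Set V) ⊆ P →
      (∀ u ∈ M, G.Adj u z) → N ≤ ∑ v ∈ insert z M, w v → i ∈ c z ∨ ∃ v ∈ M, i ∈ c v := by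
    intro z _ i hi M hM _ hz hN
    have hcl : G.IsClique ((insert z M : Finset V) : Set V) := by
      rw [Finset.coe_insert]
      exact hM.insert fun u hu _ => (hz u hu).symm
    simpa using hc.hits hcl hN hi
  refine ⟨w, c, hc, ?_, ?_, ?_, ?_, ?_⟩
  · rw [hc.card_eq]; simp [hw, hx, hxy]
  · rw [hc.card_eq]; simp [hw, hy, hxy.symm]
  · intro i hi M hM hMP hN
    refine hc.hits hM ?_ hi
    rw [hsum, hfilter M hMP]
    omega
  · intro i hi M hM hMP hadj hN
    refine hext x hx i hi M hM hMP hadj ?_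
    rw [hsum, Finset.filter_insert, if_neg hx, hfilter M hMP, if_pos (Finset.mem_insert_self _ _)]
    omega
  · intro i hi M hM hMP hadj hN
    refine hext y hy i hi M hM hMP hadj ?_
    rw [hsum, Finset.filter_insert, if_neg hy, hfilter M hMP,
      if_pos (Finset.mem_insert_self y M)]
    omega

end Critical

section Antitwins

variable {V : Type*} [Fintype V] {G : SimpleGraph V} {n : ℕ}

omit [Fintype V] in
/-- A critical graph has no proper induced cycle of length five. -/
lemma IsCritical.no_five_cycle (h : IsCritical G n) {q p₀ p₁ p₂ p₃ p₄ : V}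
    (h₀₁ : G.Adj p₀ p₁) (h₁₂ : G.Adj p₁ p₂) (h₂₃ : G.Adj p₂ p₃) (h₃₄ : G.Adj p₃ p₄)
    (h₄₀ : G.Adj p₄ p₀) (h₀₂ : ¬ G.Adj p₀ p₂) (h₁₃ : ¬ G.Adj p₁ p₃) (h₂₄ : ¬ G.Adj p₂ p₄)
    (h₃₀ : ¬ G.Adj p₃ p₀) (h₄₁ : ¬ G.Adj p₄ p₁)
    (hq : q ≠ p₀ ∧ q ≠ p₁ ∧ q ≠ p₂ ∧ q ≠ p₃ ∧ q ≠ p₄) : False := by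
  classical
  set w : V → ℕ := fun v => (if v = p₀ then 1 else 0) + (if v = p₁ then 1 else 0) +
    (if v = p₂ then 1 else 0) + (if v = p₃ then 1 else 0) + (if v = p₄ then 1 else 0) with hw
  obtain ⟨c, hc⟩ := h.proper {q}ᶜ (fun heq => (Set.ext_iff.1 heq q).2 trivial rfl) w
    (fun v hv => by
      have : v = q := by simpa using hv
      simp [hw, this, hq]) 2 (fun K hK => by
      have hnot : ∀ u v, u ≠ v → ¬ G.Adj u v → u ∈ K → v ∉ K := fun u v huv hadj hu hv =>
        hadj (hK hu hv huv)
      have n₀₂ := hnot p₀ p₂ (fun he => h₃₀ (he ▸ h₂₃.symm)) h₀₂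
      have n₁₃ := hnot p₁ p₃ (fun he => h₄₁ (he ▸ h₃₄.symm)) h₁₃
      have n₂₄ := hnot p₂ p₄ (fun he => h₀₂ (he ▸ h₄₀.symm)) h₂₄
      have n₃₀ := hnot p₃ p₀ (fun he => h₁₃ (he ▸ h₀₁.symm)) h₃₀
      have n₄₁ := hnot p₄ p₁ (fun he => h₂₄ (he ▸ h₁₂.symm)) h₄₁
      simp only [hw, Finset.sum_add_distrib, Finset.sum_ite_eq']
      by_cases m₀ : p₀ ∈ K <;> by_cases m₁ : p₁ ∈ K <;> by_cases m₂ : p₂ ∈ K <;>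
        by_cases m₃ : p₃ ∈ K <;> by_cases m₄ : p₄ ∈ K <;> simp_all)
  obtain ⟨i₀, m₀⟩ := hc.exists_mem (v := p₀) (by simp [hw])
  obtain ⟨i₁, m₁⟩ := hc.exists_mem (v := p₁) (by simp [hw])
  obtain ⟨i₂, m₂⟩ := hc.exists_mem (v := p₂) (by simp [hw])
  obtain ⟨i₃, m₃⟩ := hc.exists_mem (v := p₃) (by simp [hw])
  obtain ⟨i₄, m₄⟩ := hc.exists_mem (v := p₄) (by simp [hw])
  have hne : ∀ {u v : V} {i j : ℕ}, G.Adj u v → i ∈ c u → j ∈ c v → i ≠ j :=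
    fun huv hi hj hij => hc.not_mem_of_adj huv hi (hij ▸ hj)
  have := hne h₀₁ m₀ m₁
  have := hne h₁₂ m₁ m₂
  have := hne h₂₃ m₂ m₃
  have := hne h₃₄ m₃ m₄
  have := hne h₄₀ m₄ m₀
  have := hc.lt m₀
  have := hc.lt m₁
  have := hc.lt m₂
  have := hc.lt m₃
  have := hc.lt m₄
  omega

/-- Every vertex other than the antitwins `q₁` and `q₂` lies in `A₁`, being adjacent to `q₁` but
not to `q₂`, or in `A₂`, being adjacent to `q₂` but not to `q₁`. -/
structure AreAntitwins (G : SimpleGraph V) (A₁ A₂ : Set V) (q₁ q₂ : V) : Prop where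
  ne : q₁ ≠ q₂
  cover : ∀ v, v = q₁ ∨ v = q₂ ∨ v ∈ A₁ ∨ v ∈ A₂
  adj₁ : ∀ a ∈ A₁, G.Adj q₁ a ∧ ¬ G.Adj q₂ a ∧ a ≠ q₂
  adj₂ : ∀ a ∈ A₂, G.Adj q₂ a ∧ ¬ G.Adj q₁ a ∧ a ≠ q₁

omit [Fintype V] in
lemma AreAntitwins.compl {A₁ A₂ : Set V} {q₁ q₂ : V} (h : AreAntitwins G A₁ A₂ q₁ q₂) :
    AreAntitwins Gᶜ A₂ A₁ q₁ q₂ where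
  ne := h.ne
  cover v := by have := h.cover v; tauto
  adj₁ a ha := by
    obtain ⟨h1, h2, h3⟩ := h.adj₂ a ha
    exact ⟨(G.compl_adj _ _).2 ⟨h3.symm, h2⟩, fun hc => ((G.compl_adj _ _).1 hc).2 h1, h1.ne.symm⟩
  adj₂ a ha := by
    obtain ⟨h1, h2, h3⟩ := h.adj₁ a ha
    exact ⟨(G.compl_adj _ _).2 ⟨h3.symm, h2⟩, fun hc => ((G.compl_adj _ _).1 hc).2 h1, h1.ne.symm⟩

lemma IsCritical.exists_clique_not_extendable (h : IsCritical G n) {A₁ A₂ : Set V} {q₁ q₂ : V}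
    (hq : AreAntitwins G A₁ A₂ q₁ q₂) :
    ∃ K : Finset V, G.IsClique (K : Set V) ∧ (K : Set V) ⊆ A₁ ∧
      ∀ b ∈ A₂, ∃ a ∈ K, ¬ G.Adj b a := by
  classical
  have hw : ∀ K : Finset V, q₁ ∉ K → ∑ v ∈ K, (if v = q₁ then 0 else 1) = K.card := fun K hK => by
    rw [Finset.card_eq_sum_ones]
    exact Finset.sum_congr rfl fun v hv => if_neg fun he : v = q₁ => hK (he ▸ hv)
  obtain ⟨c, hc⟩ := h.proper {q₁}ᶜ (fun heq => (Set.ext_iff.1 heq q₁).2 trivial rfl)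
    (fun v => if v = q₁ then 0 else 1) (fun v hv => by simpa using hv) n (fun K hK => by
      refine le_trans ?_ (h.bound K hK)
      rw [Finset.card_eq_sum_ones]
      exact Finset.sum_le_sum fun v _ => by split_ifs <;> simp)
  obtain ⟨i, hi⟩ := hc.exists_mem (v := q₂) (by simp [hq.ne.symm])
  obtain ⟨L, hL, hLn, hLi⟩ := h.exists_clique_avoiding (hc.isStable i) ⟨q₂, hi⟩
  have hq₁ : q₁ ∈ L := by
    by_contra hq₁
    obtain ⟨v, hv, hvi⟩ := hc.hits hL (by rw [hw L hq₁, hLn]) (hc.lt hi)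
    exact hLi v hv hvi
  have hK : G.IsClique ((L.erase q₁ : Finset V) : Set V) :=
    hL.subset fun v hv => Finset.mem_of_mem_erase hv
  refine ⟨L.erase q₁, hK, fun v hv => ?_, fun b hb => ?_⟩
  · obtain ⟨hv1, hvL⟩ := Finset.mem_erase.1 hv
    rcases hq.cover v with rfl | rfl | hv | hv
    · exact absurd rfl hv1
    · exact absurd hi (hLi v hvL)
    · exact hv
    · exact absurd (hL hq₁ hvL hv1.symm) (hq.adj₂ v hv).2.1
  · by_contra! hcon
    have hcl : G.IsClique ((insert b (L.erase q₁) : Finset V) : Set V) := by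
      rw [Finset.coe_insert]
      exact hK.insert fun u hu _ => hcon u hu
    have hbK : b ∉ L.erase q₁ := fun hbK => (hcon b hbK).ne rfl
    have hqK : q₁ ∉ insert b (L.erase q₁) := by simp [(hq.adj₂ b hb).2.2.symm]
    have hpos : 0 < L.card := Finset.card_pos.2 ⟨_, hq₁⟩
    obtain ⟨v, hv, hvi⟩ := hc.hits hcl (by
      rw [hw _ hqK, Finset.card_insert_of_notMem hbK, Finset.card_erase_of_mem hq₁]
      omega) (hc.lt hi)
    rcases Finset.mem_insert.1 hv with rfl | hv
    · exact hc.not_mem_of_adj (hq.adj₂ v hb).1 hi hvi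
    · exact hLi v (Finset.mem_of_mem_erase hv) hvi

/-- Olariu's theorem: critical graphs have no antitwins. -/
lemma IsCritical.not_areAntitwins (h : IsCritical G n) {A₁ A₂ : Set V} {q₁ q₂ : V}
    (hA : A₁.Nonempty) (hq : AreAntitwins G A₁ A₂ q₁ q₂) : False := by
  classical
  obtain ⟨K, hK, hKA, hKext⟩ := h.exists_clique_not_extendable hq
  obtain ⟨m, hm⟩ := h.exists_compl
  obtain ⟨R, hR, hRA, hRext⟩ := hm.exists_clique_not_extendable hq.compl
  have hRst := isStable_of_isClique_compl hR
  have hnbr : ∀ a ∈ A₁, ∃ b ∈ R, G.Adj a b := fun a ha => by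
    obtain ⟨b, hb, hab⟩ := hRext a ha
    refine ⟨b, hb, ?_⟩
    by_contra hadj
    refine hab ((G.compl_adj a b).2 ⟨fun he => ?_, hadj⟩)
    exact (hq.adj₂ b (hRA hb)).2.1 (he ▸ (hq.adj₁ a ha).1)
  obtain ⟨a₀, ha₀⟩ := hA
  obtain ⟨b₀, hb₀, -⟩ := hnbr a₀ ha₀
  obtain ⟨b, hb, hmax⟩ := R.exists_max_image (fun b => (K.filter (G.Adj b ·)).card) ⟨b₀, hb₀⟩
  obtain ⟨a, ha, hba⟩ := hKext b (hRA hb)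
  obtain ⟨b', hb', hab'⟩ := hnbr a (hKA ha)
  obtain ⟨a', ha', hba', hba''⟩ : ∃ a' ∈ K, G.Adj b a' ∧ ¬ G.Adj b' a' := by
    by_contra! hcon
    refine absurd (hmax b' hb') (not_le.2 (Finset.card_lt_card ?_))
    refine Finset.ssubset_iff_subset_ne.2 ⟨fun v hv => ?_, fun he => ?_⟩
    · obtain ⟨hvK, hbv⟩ := Finset.mem_filter.1 hv
      exact Finset.mem_filter.2 ⟨hvK, hcon v hvK hbv⟩
    · have : a ∈ K.filter (G.Adj b' ·) := Finset.mem_filter.2 ⟨ha, hab'.symm⟩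
      rw [← he] at this
      exact hba (Finset.mem_filter.1 this).2
  have A := hq.adj₁ a (hKA ha)
  have A' := hq.adj₁ a' (hKA ha')
  have B := hq.adj₂ b (hRA hb)
  have B' := hq.adj₂ b' (hRA hb')
  have haa' : a' ≠ a := fun he => hba (he ▸ hba')
  exact h.no_five_cycle B.1 hba' (hK ha' ha haa') hab' B'.1.symm A'.2.1 hba
    (fun hh => hba'' hh.symm) (fun hh => A.2.1 hh.symm) (hRst b' hb' b hb)
    ⟨hq.ne, B.2.2.symm, A'.1.ne, A.1.ne, B'.2.2.symm⟩

end Antitwins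

section HomogeneousPair

variable {V : Type*} [Fintype V] {G : SimpleGraph V} {n : ℕ} {A₁ A₂ B : Set V}

/-- `a` is the largest size of a clique contained in `s`. -/
structure IsCliqueNumOn (G : SimpleGraph V) (s : Set V) (a : ℕ) : Prop where
  exists_clique : ∃ K : Finset V, G.IsClique (K : Set V) ∧ (K : Set V) ⊆ s ∧ K.card = a
  card_le : ∀ K : Finset V, G.IsClique (K : Set V) → (K : Set V) ⊆ s → K.card ≤ a

lemma exists_isCliqueNumOn (G : SimpleGraph V) (s : Set V) : ∃ a, IsCliqueNumOn G s a := by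
  classical
  obtain ⟨K, hK, hmax⟩ := (Finset.univ.filter fun K : Finset V =>
    G.IsClique (K : Set V) ∧ (K : Set V) ⊆ s).exists_max_image Finset.card ⟨∅, by simp⟩
  simp only [Finset.mem_filter, Finset.mem_univ, true_and] at hK hmax
  exact ⟨K.card, ⟨K, hK.1, hK.2, rfl⟩, fun L hL hLs => hmax L ⟨hL, hLs⟩⟩

omit [Fintype V] in
lemma IsCliqueNumOn.pos {s : Set V} {a : ℕ} (h : IsCliqueNumOn G s a) (hs : s.Nonempty) :
    0 < a := by
  obtain ⟨x, hx⟩ := hs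
  have h1 : 1 ≤ a := by simpa using h.card_le {x} (by simp) (by simpa using hx)
  exact h1

omit [Fintype V] in
lemma IsCliqueNumOn.mono {s t : Set V} {a b : ℕ} (h : IsCliqueNumOn G s a)
    (h' : IsCliqueNumOn G t b) (hst : s ⊆ t) : a ≤ b := by
  obtain ⟨K, hK, hKs, rfl⟩ := h.exists_clique
  exact h'.card_le K hK (hKs.trans hst)

omit [Fintype V] in
lemma IsCliqueNumOn.le_add {s t : Set V} {a b m : ℕ} (h : IsCliqueNumOn G s a)
    (h' : IsCliqueNumOn G t b) (hst : IsCliqueNumOn G (s ∪ t) m) : m ≤ a + b := by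
  classical
  obtain ⟨K, hK, hKs, rfl⟩ := hst.exists_clique
  rw [← Finset.card_filter_add_card_filter_not (s := K) (· ∈ s)]
  refine add_le_add (h.card_le _ (hK.subset fun v hv => (Finset.mem_filter.1 hv).1)
    fun v hv => (Finset.mem_filter.1 hv).2) (h'.card_le _
    (hK.subset fun v hv => (Finset.mem_filter.1 hv).1) fun v hv => ?_)
  have hv' := Finset.mem_filter.1 hv
  exact (hKs hv'.1).resolve_left hv'.2

/-- `T` meets every clique of at least `a` vertices contained in `s`. -/
def MeetsCliques (G : SimpleGraph V) (T s : Set V) (a : ℕ) : Prop :=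
  ∀ L : Finset V, G.IsClique (L : Set V) → (L : Set V) ⊆ s → a ≤ L.card → ∃ v ∈ L, v ∈ T

omit [Fintype V] in
lemma MeetsCliques.nonempty {T s : Set V} {a : ℕ} (h : MeetsCliques G T s a)
    (hs : IsCliqueNumOn G s a) : T.Nonempty := by
  obtain ⟨K, hK, hKs, rfl⟩ := hs.exists_clique
  obtain ⟨v, -, hv⟩ := h K hK hKs le_rfl
  exact ⟨v, hv⟩

/-- The sets `A₁`, `A₂`, `B` partition the vertices, and each vertex of `B` is adjacent to all or
none of `Aᵢ`. -/
structure IsHomogeneousPair (G : SimpleGraph V) (A₁ A₂ B : Set V) : Prop where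
  cover : ∀ v, v ∈ A₁ ∨ v ∈ A₂ ∨ v ∈ B
  disjoint : ∀ v ∈ A₁, v ∉ A₂
  not_mem₁ : ∀ v ∈ A₁, v ∉ B
  not_mem₂ : ∀ v ∈ A₂, v ∉ B
  homogeneous₁ : ∀ b ∈ B, ∀ a ∈ A₁, G.Adj b a → ∀ a' ∈ A₁, G.Adj b a'
  homogeneous₂ : ∀ b ∈ B, ∀ a ∈ A₂, G.Adj b a → ∀ a' ∈ A₂, G.Adj b a'

omit [Fintype V] in
lemma IsHomogeneousPair.symm (h : IsHomogeneousPair G A₁ A₂ B) : IsHomogeneousPair G A₂ A₁ B where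
  cover v := by have := h.cover v; tauto
  disjoint v h2 h1 := h.disjoint v h1 h2
  not_mem₁ := h.not_mem₂
  not_mem₂ := h.not_mem₁
  homogeneous₁ := h.homogeneous₂
  homogeneous₂ := h.homogeneous₁

/-- A stable set of a critical graph, given by its parts in `B` and in `A₁ ∪ A₂`, misses some
largest clique. -/
lemma IsCritical.not_meets (h : IsCritical G n) (hp : IsHomogeneousPair G A₁ A₂ B)
    {a₁ a₂ a : ℕ} (ha₁ : IsCliqueNumOn G A₁ a₁) (ha₂ : IsCliqueNumOn G A₂ a₂)
    (ha : IsCliqueNumOn G (A₁ ∪ A₂) a) {S T : Set V} (hS : IsStable G S) (hT : IsStable G T)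
    (hne : T.Nonempty) (hST : ∀ u ∈ S, ∀ v ∈ T, ¬ G.Adj u v)
    (hB : MeetsCliques G S B n)
    (h₁ : ∀ M : Finset V, G.IsClique (M : Set V) → (M : Set V) ⊆ B →
      (∀ u ∈ M, ∀ v ∈ A₁, G.Adj u v) → n ≤ M.card + a₁ → (∃ v ∈ M, v ∈ S) ∨
      MeetsCliques G T A₁ a₁)
    (h₂ : ∀ M : Finset V, G.IsClique (M : Set V) → (M : Set V) ⊆ B →
      (∀ u ∈ M, ∀ v ∈ A₂, G.Adj u v) → n ≤ M.card + a₂ → (∃ v ∈ M, v ∈ S) ∨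
      MeetsCliques G T A₂ a₂)
    (h₁₂ : ∀ M : Finset V, G.IsClique (M : Set V) → (M : Set V) ⊆ B →
      (∀ u ∈ M, ∀ v ∈ A₁ ∪ A₂, G.Adj u v) → n ≤ M.card + a → (∃ v ∈ M, v ∈ S) ∨
      MeetsCliques G T (A₁ ∪ A₂) a) : False := by
  classical
  obtain ⟨K, hK, hKn, hKST⟩ := h.exists_clique_avoiding (S := S ∪ T) (by
    rintro u (hu | hu) v (hv | hv)
    exacts [hS u hu v hv, hST u hu v hv, fun huv => hST v hv u hu huv.symm, hT u hu v hv])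
    (hne.mono Set.subset_union_right)
  set M := K.filter (· ∈ B) with hM
  set L := K.filter (· ∉ B) with hL
  have hcard : M.card + L.card = n := by
    rw [← hKn]; exact Finset.card_filter_add_card_filter_not _
  have hMK : ∀ v ∈ M, v ∈ K ∧ v ∈ B := fun v hv => Finset.mem_filter.1 hv
  have hLK : ∀ v ∈ L, v ∈ K ∧ v ∉ B := fun v hv => Finset.mem_filter.1 hv
  have hMcl : G.IsClique (M : Set V) := hK.subset fun v hv => (hMK v hv).1
  have hLcl : G.IsClique (L : Set V) := hK.subset fun v hv => (hLK v hv).1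
  have hMB : (M : Set V) ⊆ B := fun v hv => (hMK v hv).2
  have hMS : ¬ ∃ v ∈ M, v ∈ S := fun ⟨v, hv, hvS⟩ => hKST v (hMK v hv).1 (Or.inl hvS)
  have hLT : ¬ ∃ v ∈ L, v ∈ T := fun ⟨v, hv, hvT⟩ => hKST v (hLK v hv).1 (Or.inr hvT)
  have hadj : ∀ u ∈ M, ∀ v ∈ L, G.Adj u v := fun u hu v hv =>
    hK (hMK u hu).1 (hLK v hv).1 fun he => (hLK v hv).2 (he ▸ (hMK u hu).2)
  have key : ∀ (s : Set V) (m : ℕ), IsCliqueNumOn G s m → (L : Set V) ⊆ s →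
      (∀ u ∈ M, ∀ v ∈ s, G.Adj u v) →
      (n ≤ M.card + m → (∃ v ∈ M, v ∈ S) ∨ MeetsCliques G T s m) → False := by
    intro s m hm hLs hMs hmeet
    obtain ⟨L', hL', hL's, hL'm⟩ := hm.exists_clique
    have h1 := h.card_add_card_le hL' hMcl fun u hu v hv => hMs u hu v (hL's hv)
    have h2 := hm.card_le L hLcl hLs
    rcases hmeet (by omega) with hh | hh
    · exact hMS hh
    · exact hLT (hh L hLcl hLs (by omega))
  by_cases hL₁ : ∃ v ∈ L, v ∈ A₁ <;> by_cases hL₂ : ∃ v ∈ L, v ∈ A₂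
  · obtain ⟨x, hxL, hx⟩ := hL₁
    obtain ⟨z, hzL, hz⟩ := hL₂
    have hall : ∀ u ∈ M, ∀ v ∈ A₁ ∪ A₂, G.Adj u v := by
      rintro u hu v (hv | hv)
      · exact hp.homogeneous₁ u (hMB hu) x hx (hadj u hu x hxL) v hv
      · exact hp.homogeneous₂ u (hMB hu) z hz (hadj u hu z hzL) v hv
    refine key _ a ha (fun v hv => ?_) hall (h₁₂ M hMcl hMB hall)
    have := hp.cover v
    have := (hLK v hv).2
    simp only [Set.mem_union]; tauto
  · obtain ⟨x, hxL, hx⟩ := hL₁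
    have hall : ∀ u ∈ M, ∀ v ∈ A₁, G.Adj u v := fun u hu v hv =>
      hp.homogeneous₁ u (hMB hu) x hx (hadj u hu x hxL) v hv
    refine key _ a₁ ha₁ (fun v hv => ?_) hall (h₁ M hMcl hMB hall)
    rcases hp.cover v with hv1 | hv2 | hv3
    exacts [hv1, absurd ⟨v, hv, hv2⟩ hL₂, absurd hv3 (hLK v hv).2]
  · obtain ⟨z, hzL, hz⟩ := hL₂
    have hall : ∀ u ∈ M, ∀ v ∈ A₂, G.Adj u v := fun u hu v hv =>
      hp.homogeneous₂ u (hMB hu) z hz (hadj u hu z hzL) v hv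
    refine key _ a₂ ha₂ (fun v hv => ?_) hall (h₂ M hMcl hMB hall)
    rcases hp.cover v with hv1 | hv2 | hv3
    exacts [absurd ⟨v, hv, hv1⟩ hL₁, hv2, absurd hv3 (hLK v hv).2]
  · have hLempty : L = ∅ := Finset.eq_empty_of_forall_notMem fun v hv => by
      rcases hp.cover v with hv1 | hv2 | hv3
      exacts [hL₁ ⟨v, hv, hv1⟩, hL₂ ⟨v, hv, hv2⟩, (hLK v hv).2 hv3]
    refine hMS (hB M hMcl hMB ?_)
    rw [hLempty, Finset.card_empty] at hcard
    omega

/-- The case in which every vertex of `B` with a neighbor in `A₁` is adjacent to all of `A₂`. -/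
lemma IsCritical.false_of_dominated (h : IsCritical G n) (hp : IsHomogeneousPair G A₁ A₂ B)
    {y z b b' : V} (hz : z ∈ A₂) (hy : y ∈ A₁ ∪ A₂) (hyz : y ≠ z) (hb : b ∈ B) (hb' : b' ∈ B)
    (hbb' : b ≠ b') (hdom : ∀ b ∈ B, ∀ a ∈ A₁, G.Adj b a → ∀ a' ∈ A₂, G.Adj b a') : False := by
  obtain ⟨a₁, ha₁⟩ := exists_isCliqueNumOn G A₁
  obtain ⟨a₂, ha₂⟩ := exists_isCliqueNumOn G A₂
  obtain ⟨a, ha⟩ := exists_isCliqueNumOn G (A₁ ∪ A₂)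
  have hnotB : ∀ v ∈ A₁ ∪ A₂, v ∉ B := by
    rintro v (hv | hv)
    exacts [hp.not_mem₁ v hv, hp.not_mem₂ v hv]
  have hnotA : ∀ v ∈ B, v ∉ A₁ ∪ A₂ := fun v hv hvA => hnotB v hvA hv
  have ha₂pos := ha₂.pos ⟨z, hz⟩
  have ha₁a := ha₁.mono ha Set.subset_union_left
  have ha₂a := ha₂.mono ha Set.subset_union_right
  have hadjz : ∀ u ∈ B, G.Adj u z → ∀ v ∈ A₂, G.Adj u v := fun u hu huz =>
    hp.homogeneous₂ u hu z hz huz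
  have hle₂ : ∀ M : Finset V, G.IsClique (M : Set V) → (M : Set V) ⊆ B →
      (∀ u ∈ M, G.Adj u z) → M.card + a₂ ≤ n := fun M hM hMB hMz => by
    obtain ⟨L, hL, hLA, rfl⟩ := ha₂.exists_clique
    rw [add_comm]
    exact h.card_add_card_le hL hM fun u hu v hv => hadjz u (hMB hu) (hMz u hu) v (hLA hv)
  obtain ⟨w, c, hc, hcz, -, hcB, -, -⟩ := h.exists_multicoloring_two_points (P := B) (x := z)
    (y := y) (d := a₂) (e := 0) (N := n) (hp.not_mem₂ z hz) (hnotB y hy) hyz.symm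
    ⟨y, hnotB y hy, fun he => absurd he hyz, fun _ => rfl⟩ (fun M hM _ => h.bound M hM) hle₂
    (fun M hM _ _ => h.bound M hM) (fun _ M hM hMB hMz _ => hle₂ M hM hMB hMz)
  obtain ⟨i, hi⟩ : (c z).Nonempty := Finset.card_pos.1 (by omega)
  have hT : ∃ T : Set V, T ⊆ A₁ ∪ A₂ ∧ IsStable G T ∧ MeetsCliques G T (A₁ ∪ A₂) a ∧
      (MeetsCliques G T A₂ a₂ ∨ ∀ u ∈ B, G.Adj u z → ∀ v ∈ A₁, G.Adj u v) := by
    have step : ∀ q q' : V, q ∈ B → q' ∈ B → q ≠ q' → ∀ d < a,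
        (∀ M : Finset V, G.IsClique (M : Set V) → (M : Set V) ⊆ A₁ ∪ A₂ →
          (∀ u ∈ M, G.Adj u q) → M.card + d ≤ a) →
        ∃ T : Set V, T ⊆ A₁ ∪ A₂ ∧ IsStable G T ∧ MeetsCliques G T (A₁ ∪ A₂) a ∧
          ((∀ v ∈ A₂, G.Adj v q) → a ≤ a₂ + d → MeetsCliques G T A₂ a₂) := by
      intro q q' hq hq' hqq' d hd hle
      obtain ⟨w', c', hc', hc'q, -, hc'A, hc'x, -⟩ := h.exists_multicoloring_two_points
        (P := A₁ ∪ A₂) (x := q) (y := q') (d := d) (e := 0) (N := a) (hnotA q hq) (hnotA q' hq')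
        hqq' ⟨q', hnotA q' hq', fun he => absurd he.symm hqq', fun _ => rfl⟩ ha.card_le hle
        (fun M hM hMA _ => ha.card_le M hM hMA) (fun _ M hM hMA hMq _ => hle M hM hMA hMq)
      obtain ⟨j, hj, hjq⟩ : ∃ j ∈ Finset.range a, j ∉ c' q := by
        by_contra! hcon
        have := Finset.card_le_card hcon
        rw [Finset.card_range] at this
        omega
      rw [Finset.mem_range] at hj
      refine ⟨{v | v ∈ A₁ ∪ A₂ ∧ j ∈ c' v}, fun v hv => hv.1,
        fun u hu v hv => hc'.isStable j u hu.2 v hv.2, fun L hL hLA hLa => ?_,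
        fun hadj had L hL hLA hLa => ?_⟩
      · obtain ⟨v, hv, hvj⟩ := hc'A j hj L hL hLA hLa
        exact ⟨v, hv, hLA hv, hvj⟩
      · have hLA' := hLA.trans (Set.subset_union_right (s := A₁))
        obtain ⟨v, hv, hvj⟩ := (hc'x j hj L hL hLA' (fun u hu => hadj u (hLA hu))
          (by omega)).resolve_left hjq
        exact ⟨v, hv, hLA' hv, hvj⟩
    by_cases hB₂ : ∃ q ∈ B, G.Adj q z ∧ ∀ v ∈ A₁, ¬ G.Adj q v
    · obtain ⟨q, hq, hqz, hqA₁⟩ := hB₂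
      obtain ⟨q', hq', hqq'⟩ : ∃ q' ∈ B, q ≠ q' := by
        by_cases hqb : q = b
        exacts [⟨b', hb', hqb ▸ hbb'⟩, ⟨b, hb, hqb⟩]
      obtain ⟨T, hTA, hTst, hTm, hTm₂⟩ := step q q' hq hq' hqq' (a - a₂) (by omega)
        (fun M hM hMA hMq => by
          have := ha₂.card_le M hM fun v hv =>
            (hMA hv).resolve_left fun hv1 => hqA₁ v hv1 (hMq v hv).symm
          omega)
      exact ⟨T, hTA, hTst, hTm, Or.inl (hTm₂ (fun v hv => (hadjz q hq hqz v hv).symm) (by omega))⟩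
    · obtain ⟨T, hTA, hTst, hTm, -⟩ := step b b' hb hb' hbb' 0 (by omega)
        (fun M hM hMA _ => ha.card_le M hM hMA)
      refine ⟨T, hTA, hTst, hTm, Or.inr fun u hu huz => ?_⟩
      by_contra! hcon
      obtain ⟨v, hv, huv⟩ := hcon
      exact hB₂ ⟨u, hu, huz, fun v' hv' huv' => huv (hp.homogeneous₁ u hu v' hv' huv' v hv)⟩
  obtain ⟨T, hTA, hTst, hTm, hTm₂⟩ := hT
  have htight : ∀ M : Finset V, G.IsClique (M : Set V) →
      (∀ u ∈ M, ∀ v ∈ A₁ ∪ A₂, G.Adj u v) → M.card + a ≤ n := fun M hM hMA => by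
    obtain ⟨L, hL, hLA, rfl⟩ := ha.exists_clique
    rw [add_comm]
    exact h.card_add_card_le hL hM fun u hu v hv => hMA u hu v (hLA hv)
  refine h.not_meets hp ha₁ ha₂ ha (S := {v | v ∈ B ∧ i ∈ c v})
    (fun u hu v hv => hc.isStable i u hu.2 v hv.2) hTst (hTm.nonempty ha) ?_ ?_ ?_ ?_ ?_
  · rintro u ⟨huB, hui⟩ v hv huv
    refine hc.not_mem_of_adj (v := z) ?_ hui hi
    rcases hTA hv with hv | hv
    · exact hdom u huB v hv huv z hz
    · exact hp.homogeneous₂ u huB v hv huv z hz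
  · intro M hM hMB hMn
    obtain ⟨v, hv, hvi⟩ := hcB i (hc.lt hi) M hM hMB hMn
    exact ⟨v, hv, hMB hv, hvi⟩
  · intro M hM hMB hMA hMn
    by_cases hA₁ : A₁.Nonempty
    · obtain ⟨x, hx⟩ := hA₁
      have := htight M hM (by
        rintro u hu v (hv | hv)
        exacts [hMA u hu v hv, hdom u (hMB hu) x hx (hMA u hu x hx) v hv])
      exact Or.inr fun L hL hLA hLa =>
        hTm L hL (hLA.trans Set.subset_union_left) (by omega)
    · left
      have ha₁0 : a₁ = 0 := by
        obtain ⟨L, hL, hLA, rfl⟩ := ha₁.exists_clique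
        exact Finset.card_eq_zero.2 (Finset.eq_empty_of_forall_notMem fun v hv =>
          hA₁ ⟨v, hLA hv⟩)
      obtain ⟨v, hv, hvi⟩ := hcB i (hc.lt hi) M hM hMB (by omega)
      exact ⟨v, hv, hMB hv, hvi⟩
  · intro M hM hMB hMA hMn
    refine Or.inr (hTm₂.elim id fun hall => ?_)
    have := htight M hM (by
      rintro u hu v (hv | hv)
      exacts [hall u (hMB hu) (hMA u hu z hz) v hv, hMA u hu v hv])
    exact fun L hL hLA hLa => hTm L hL (hLA.trans Set.subset_union_right) (by omega)
  · exact fun _ _ _ _ _ => Or.inr hTm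

/-- The case in which both kinds of one-sided vertices occur in `B`, and `B` has a third vertex. -/
lemma IsCritical.false_of_three_le (h : IsCritical G n) (hp : IsHomogeneousPair G A₁ A₂ B)
    {x₀ z₀ q₁ q₂ b : V} (hx₀ : x₀ ∈ A₁) (hz₀ : z₀ ∈ A₂)
    (hA : ∀ x z : V, ∃ v ∈ A₁ ∪ A₂, v ≠ x ∧ v ≠ z)
    (hq₁ : q₁ ∈ B) (hq₂ : q₂ ∈ B) (hb : b ∈ B) (hbq₁ : b ≠ q₁) (hbq₂ : b ≠ q₂)
    (hq₁A : (∀ v ∈ A₁, G.Adj q₁ v) ∧ ∀ v ∈ A₂, ¬ G.Adj q₁ v)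
    (hq₂A : (∀ v ∈ A₂, G.Adj q₂ v) ∧ ∀ v ∈ A₁, ¬ G.Adj q₂ v) : False := by
  classical
  obtain ⟨a₁, ha₁⟩ := exists_isCliqueNumOn G A₁
  obtain ⟨a₂, ha₂⟩ := exists_isCliqueNumOn G A₂
  obtain ⟨a, ha⟩ := exists_isCliqueNumOn G (A₁ ∪ A₂)
  have hnotB : ∀ v ∈ A₁ ∪ A₂, v ∉ B := by
    rintro v (hv | hv)
    exacts [hp.not_mem₁ v hv, hp.not_mem₂ v hv]
  have hnotA : ∀ v ∈ B, v ∉ A₁ ∪ A₂ := fun v hv hvA => hnotB v hvA hv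
  have ha₁pos := ha₁.pos ⟨x₀, hx₀⟩
  have ha₂pos := ha₂.pos ⟨z₀, hz₀⟩
  have ha₁a := ha₁.mono ha Set.subset_union_left
  have ha₂a := ha₂.mono ha Set.subset_union_right
  have hadd := ha₁.le_add ha₂ ha
  have hM₁ : ∀ M : Finset V, (M : Set V) ⊆ A₁ ∪ A₂ → (∀ u ∈ M, G.Adj u q₁) → (M : Set V) ⊆ A₁ :=
    fun M hM hMq v hv => (hM hv).resolve_right fun hv2 => hq₁A.2 v hv2 (hMq v hv).symm
  have hM₂ : ∀ M : Finset V, (M : Set V) ⊆ A₁ ∪ A₂ → (∀ u ∈ M, G.Adj u q₂) → (M : Set V) ⊆ A₂ :=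
    fun M hM hMq v hv => (hM hv).resolve_left fun hv1 => hq₂A.2 v hv1 (hMq v hv).symm
  obtain ⟨w', D, hD, hDq₁, hDq₂, hDA, hDx, hDy⟩ := h.exists_multicoloring_two_points
    (P := A₁ ∪ A₂) (x := q₁) (y := q₂) (d := a - a₁) (e := a - a₂) (N := a)
    (hnotA _ hq₁) (hnotA _ hq₂) (fun he => hq₂A.2 x₀ hx₀ (he ▸ hq₁A.1 x₀ hx₀))
    ⟨b, hnotA b hb, fun he => absurd he hbq₁, fun he => absurd he hbq₂⟩ ha.card_le
    (fun M hM hMA hMq => by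
      have := ha₁.card_le M hM (hM₁ M hMA hMq)
      omega)
    (fun M hM hMA hMq => by
      have := ha₂.card_le M hM (hM₂ M hMA hMq)
      omega)
    (fun _ M hM hMA hMq hMq' => by
      have : M = ∅ := Finset.eq_empty_of_forall_notMem fun v hv =>
        hp.disjoint v (hM₁ M hMA hMq hv) (hM₂ M hMA hMq' hv)
      rw [this, Finset.card_empty]
      omega)
  have hTboth : a < a₁ + a₂ → ∃ T : Set V, T ⊆ A₁ ∪ A₂ ∧ IsStable G T ∧
      MeetsCliques G T A₁ a₁ ∧ MeetsCliques G T A₂ a₂ ∧ MeetsCliques G T (A₁ ∪ A₂) a := by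
    intro hlt
    obtain ⟨j, hj, hjq⟩ : ∃ j ∈ Finset.range a, j ∉ D q₁ ∪ D q₂ := by
      by_contra! hcon
      have := Finset.card_le_card hcon
      have := Finset.card_union_le (D q₁) (D q₂)
      rw [Finset.card_range] at *
      omega
    rw [Finset.mem_range] at hj
    rw [Finset.mem_union, not_or] at hjq
    refine ⟨{v | v ∈ A₁ ∪ A₂ ∧ j ∈ D v}, fun v hv => hv.1,
        fun u hu v hv => hD.isStable j u hu.2 v hv.2, fun L hL hLA hLa => ?_,
        fun L hL hLA hLa => ?_, fun L hL hLA hLa => ?_⟩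
    · have hLA' := hLA.trans (Set.subset_union_left (t := A₂))
      obtain ⟨v, hv, hvj⟩ := (hDx j hj L hL hLA' (fun u hu => (hq₁A.1 u (hLA hu)).symm)
        (by omega)).resolve_left hjq.1
      exact ⟨v, hv, hLA' hv, hvj⟩
    · have hLA' := hLA.trans (Set.subset_union_right (s := A₁))
      obtain ⟨v, hv, hvj⟩ := (hDy j hj L hL hLA' (fun u hu => (hq₂A.1 u (hLA hu)).symm)
        (by omega)).resolve_left hjq.2
      exact ⟨v, hv, hLA' hv, hvj⟩
    · obtain ⟨v, hv, hvj⟩ := hDA j hj L hL hLA hLa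
      exact ⟨v, hv, hLA hv, hvj⟩
  have hTone : ∃ T : Set V, T ⊆ A₁ ∧ IsStable G T ∧ MeetsCliques G T A₁ a₁ ∧
      (MeetsCliques G T (A₁ ∪ A₂) a ∨ a ≤ a₂) := by
    have step : ∀ j < a, j ∉ D q₁ → MeetsCliques G {v | v ∈ A₁ ∧ j ∈ D v} A₁ a₁ := by
      intro j hj hjq L hL hLA hLa
      obtain ⟨v, hv, hvj⟩ := (hDx j hj L hL (hLA.trans Set.subset_union_left)
        (fun u hu => (hq₁A.1 u (hLA hu)).symm) (by omega)).resolve_left hjq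
      exact ⟨v, hv, hLA hv, hvj⟩
    by_cases haa : a ≤ a₂
    · obtain ⟨j, hj, hjq⟩ : ∃ j ∈ Finset.range a, j ∉ D q₁ := by
        by_contra! hcon
        have := Finset.card_le_card hcon
        rw [Finset.card_range] at this
        omega
      exact ⟨_, fun v hv => hv.1, fun u hu v hv => hD.isStable j u hu.2 v hv.2,
        step j (Finset.mem_range.1 hj) hjq, Or.inr haa⟩
    · obtain ⟨j, hj⟩ : (D q₂).Nonempty := Finset.card_pos.1 (by omega)
      have hA₂ : ∀ v ∈ A₂, j ∉ D v := fun v hv => hD.not_mem_of_adj (hq₂A.1 v hv) hj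
      have hmeet : MeetsCliques G {v | v ∈ A₁ ∧ j ∈ D v} (A₁ ∪ A₂) a := fun L hL hLA hLa => by
        obtain ⟨v, hv, hvj⟩ := hDA j (hD.lt hj) L hL hLA hLa
        exact ⟨v, hv, (hLA hv).resolve_right fun hv2 => hA₂ v hv2 hvj, hvj⟩
      obtain ⟨v, hvA, hvj⟩ := hmeet.nonempty ha
      exact ⟨_, fun v hv => hv.1, fun u hu v hv => hD.isStable j u hu.2 v hv.2,
        step j (hD.lt hj) fun hjq => hD.not_mem_of_adj (hq₁A.1 v hvA) hjq hvj, Or.inl hmeet⟩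
  obtain ⟨x, hx, z, hz, hxz⟩ : ∃ x ∈ A₁, ∃ z ∈ A₂, G.Adj x z ↔ a = a₁ + a₂ := by
    by_cases heq : a = a₁ + a₂
    · obtain ⟨L, hL, hLA, hLa⟩ := ha.exists_clique
      obtain ⟨x, hxL, hx⟩ : ∃ x ∈ L, x ∈ A₁ := by
        by_contra! hcon
        have := ha₂.card_le L hL fun v hv => (hLA hv).resolve_left (hcon v hv)
        omega
      obtain ⟨z, hzL, hz⟩ : ∃ z ∈ L, z ∈ A₂ := by
        by_contra! hcon
        have := ha₁.card_le L hL fun v hv => (hLA hv).resolve_right (hcon v hv)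
        omega
      exact ⟨x, hx, z, hz, iff_of_true
        (hL hxL hzL fun he => hp.disjoint x hx (he ▸ hz)) heq⟩
    · by_contra! hcon
      obtain ⟨L₁, hL₁, hL₁A, hL₁a⟩ := ha₁.exists_clique
      obtain ⟨L₂, hL₂, hL₂A, hL₂a⟩ := ha₂.exists_clique
      have hadj : ∀ u ∈ L₁, ∀ v ∈ L₂, G.Adj u v := fun u hu v hv => by
        have := hcon u (hL₁A hu) v (hL₂A hv)
        tauto
      have hcl : G.IsClique ((L₁ ∪ L₂ : Finset V) : Set V) := by
        rw [Finset.coe_union]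
        rintro u (hu | hu) v (hv | hv) huv
        exacts [hL₁ hu hv huv, hadj u hu v hv, (hadj v hv u hu).symm, hL₂ hu hv huv]
      have hle := ha.card_le _ hcl (by
        rw [Finset.coe_union]; exact Set.union_subset_union hL₁A hL₂A)
      rw [Finset.card_union_of_disjoint
        (Finset.disjoint_left.2 fun v hv hv' => (hadj v hv v hv').ne rfl)] at hle
      omega
  have hle : ∀ (s : Set V) (m : ℕ), IsCliqueNumOn G s m → ∀ M : Finset V,
      G.IsClique (M : Set V) → (∀ u ∈ M, ∀ v ∈ s, G.Adj u v) → M.card + m ≤ n := by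
    intro s m hm M hM hMs
    obtain ⟨L, hL, hLs, rfl⟩ := hm.exists_clique
    rw [add_comm]
    exact h.card_add_card_le hL hM fun u hu v hv => hMs u hu v (hLs hv)
  have hAx : ∀ u ∈ B, G.Adj u x → ∀ v ∈ A₁, G.Adj u v := fun u hu hux =>
    hp.homogeneous₁ u hu x hx hux
  have hAz : ∀ u ∈ B, G.Adj u z → ∀ v ∈ A₂, G.Adj u v := fun u hu huz =>
    hp.homogeneous₂ u hu z hz huz
  obtain ⟨v₀, hv₀, hv₀x, hv₀z⟩ := hA x z
  obtain ⟨w, c, hc, hcx, hcz, hcB, -, hcM⟩ := h.exists_multicoloring_two_points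
    (P := B) (x := x) (y := z) (d := a₁) (e := a₂) (N := n) (hp.not_mem₁ x hx) (hp.not_mem₂ z hz)
    (fun he => hp.disjoint x hx (he ▸ hz))
    ⟨v₀, hnotB v₀ hv₀, fun he => absurd he hv₀x, fun he => absurd he hv₀z⟩
    (fun M hM _ => h.bound M hM)
    (fun M hM hMB hMx => hle A₁ a₁ ha₁ M hM fun u hu => hAx u (hMB hu) (hMx u hu))
    (fun M hM hMB hMz => hle A₂ a₂ ha₂ M hM fun u hu => hAz u (hMB hu) (hMz u hu))
    (fun hadj M hM hMB hMx hMz => by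
      have := hle (A₁ ∪ A₂) a ha M hM (by
        rintro u hu v (hv | hv)
        exacts [hAx u (hMB hu) (hMx u hu) v hv, hAz u (hMB hu) (hMz u hu) v hv])
      have := hxz.1 hadj
      omega)
  have hmeetB : ∀ i < n, MeetsCliques G {v | v ∈ B ∧ i ∈ c v} B n := fun i hi M hM hMB hMn => by
    obtain ⟨v, hv, hvi⟩ := hcB i hi M hM hMB hMn
    exact ⟨v, hv, hMB hv, hvi⟩
  by_cases hsub : c x ⊆ c z
  · obtain ⟨i, hi⟩ : (c x).Nonempty := Finset.card_pos.1 (by omega)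
    have hnadj : ¬ G.Adj x z := fun hadj => hc.not_mem_of_adj hadj hi (hsub hi)
    obtain ⟨T, hTA, hT, hT₁, hT₂, hT₁₂⟩ := hTboth
      (lt_of_le_of_ne hadd fun he => hnadj (hxz.2 he))
    refine h.not_meets hp ha₁ ha₂ ha (fun u hu v hv => hc.isStable i u hu.2 v hv.2) hT
      (hT₁.nonempty ha₁) ?_ (hmeetB i (hc.lt hi)) (fun _ _ _ _ _ => Or.inr hT₁)
      (fun _ _ _ _ _ => Or.inr hT₂) (fun _ _ _ _ _ => Or.inr hT₁₂)
    rintro u ⟨huB, hui⟩ v hv huv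
    rcases hTA hv with hv | hv
    · exact hc.not_mem_of_adj (hp.homogeneous₁ u huB v hv huv x hx) hui hi
    · exact hc.not_mem_of_adj (hp.homogeneous₂ u huB v hv huv z hz) hui (hsub hi)
  · obtain ⟨i, hi, hiz⟩ := Finset.not_subset.1 hsub
    obtain ⟨T, hTA, hT, hT₁, hT₁₂⟩ := hTone
    refine h.not_meets hp ha₁ ha₂ ha (S := {v | v ∈ B ∧ i ∈ c v})
      (fun u hu v hv => hc.isStable i u hu.2 v hv.2) hT
      (hT₁.nonempty ha₁) ?_ (hmeetB i (hc.lt hi)) (fun _ _ _ _ _ => Or.inr hT₁) ?_ ?_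
    · rintro u ⟨huB, hui⟩ v hv huv
      exact hc.not_mem_of_adj (hp.homogeneous₁ u huB v (hTA hv) huv x hx) hui hi
    · intro M hM hMB hMA hMn
      obtain ⟨v, hv, hvi⟩ := (hcM i (hc.lt hi) M hM hMB (fun u hu => hMA u hu z hz)
        hMn).resolve_left hiz
      exact Or.inl ⟨v, hv, hMB hv, hvi⟩
    · intro M hM hMB hMA hMn
      rcases hT₁₂ with hT₁₂ | haa
      · exact Or.inr hT₁₂
      · obtain ⟨v, hv, hvi⟩ := (hcM i (hc.lt hi) M hM hMB (fun u hu => hMA u hu z (Or.inr hz))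
          (by omega)).resolve_left hiz
        exact Or.inl ⟨v, hv, hMB hv, hvi⟩

lemma IsCritical.false_of_isHomogeneousPair (h : IsCritical G n)
    (hp : IsHomogeneousPair G A₁ A₂ B) (hA : ∀ x z : V, ∃ v ∈ A₁ ∪ A₂, v ≠ x ∧ v ≠ z) {b b' : V}
    (hb : b ∈ B) (hb' : b' ∈ B) (hbb' : b ≠ b') : False := by
  have hdom : ∀ z ∈ A₂, ¬ ∀ b ∈ B, ∀ a ∈ A₁, G.Adj b a → ∀ a' ∈ A₂, G.Adj b a' := by
    intro z hz hdom
    obtain ⟨y, hy, hyz, -⟩ := hA z z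
    exact h.false_of_dominated hp hz hy hyz hb hb' hbb' hdom
  have hdom' : ∀ x ∈ A₁, ¬ ∀ b ∈ B, ∀ a ∈ A₂, G.Adj b a → ∀ a' ∈ A₁, G.Adj b a' := by
    intro x hx hdom
    obtain ⟨y, hy, hyx, -⟩ := hA x x
    exact h.false_of_dominated hp.symm hx (Or.symm hy) hyx hb hb' hbb' hdom
  obtain ⟨v₀, hv₀, -⟩ := hA b b
  obtain ⟨x, hx⟩ : A₁.Nonempty := by
    rcases hv₀ with hv | hv
    · exact ⟨_, hv⟩
    · by_contra hne
      exact hdom v₀ hv fun _ _ a ha => absurd ⟨a, ha⟩ hne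
  obtain ⟨z, hz⟩ : A₂.Nonempty := by
    by_contra hne
    exact hdom' x hx fun _ _ a ha => absurd ⟨a, ha⟩ hne
  have h1 := hdom z hz
  have h2 := hdom' x hx
  push Not at h1 h2
  obtain ⟨q₁, hq₁, u₁, hu₁, hadj₁, v₁, hv₁, hnadj₁⟩ := h1
  obtain ⟨q₂, hq₂, u₂, hu₂, hadj₂, v₂, hv₂, hnadj₂⟩ := h2
  have hq₁A : (∀ v ∈ A₁, G.Adj q₁ v) ∧ ∀ v ∈ A₂, ¬ G.Adj q₁ v :=
    ⟨hp.homogeneous₁ q₁ hq₁ u₁ hu₁ hadj₁,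
      fun v hv hadj => hnadj₁ (hp.homogeneous₂ q₁ hq₁ v hv hadj v₁ hv₁)⟩
  have hq₂A : (∀ v ∈ A₂, G.Adj q₂ v) ∧ ∀ v ∈ A₁, ¬ G.Adj q₂ v :=
    ⟨hp.homogeneous₂ q₂ hq₂ u₂ hu₂ hadj₂,
      fun v hv hadj => hnadj₂ (hp.homogeneous₁ q₂ hq₂ v hv hadj v₂ hv₂)⟩
  by_cases hthird : ∃ v ∈ B, v ≠ q₁ ∧ v ≠ q₂
  · obtain ⟨v, hv, hvq₁, hvq₂⟩ := hthird
    exact h.false_of_three_le hp hx hz hA hq₁ hq₂ hv hvq₁ hvq₂ hq₁A hq₂A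
  · refine h.not_areAntitwins (A₁ := A₁) (A₂ := A₂) (q₁ := q₁) (q₂ := q₂) ⟨x, hx⟩ ⟨?_, ?_, ?_, ?_⟩
    · exact fun he => hq₁A.2 z hz (he ▸ hq₂A.1 z hz)
    · intro v
      rcases hp.cover v with hv | hv | hv
      · exact Or.inr (Or.inr (Or.inl hv))
      · exact Or.inr (Or.inr (Or.inr hv))
      · by_contra! hcon
        exact hthird ⟨v, hv, hcon.1, hcon.2.1⟩
    · exact fun a ha => ⟨hq₁A.1 a ha, hq₂A.2 a ha, fun he => hp.not_mem₁ a ha (he ▸ hq₂)⟩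
    · exact fun a ha => ⟨hq₂A.1 a ha, hq₁A.2 a ha, fun he => hp.not_mem₂ a ha (he ▸ hq₁)⟩

end HomogeneousPair

/-- No minimally imperfect graph contains a homogeneous pair. -/
theorem no_homogeneous_pair {V : Type*} [Fintype V] (G : SimpleGraph V)
    (hmi : MinimallyImperfect G) :
    ¬ HasHomogeneousPair G := by
  rintro ⟨A₁, A₂, B, hcov, h₁₂, h₁B, h₂B, hA, hB, hom₁, hom₂⟩
  obtain ⟨n, h⟩ := hmi.exists_isCritical
  obtain ⟨b, hb, b', hb', hbb'⟩ := (Set.one_lt_ncard (Set.toFinite B)).1 hB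
  refine h.false_of_isHomogeneousPair (A₁ := A₁) (A₂ := A₂) (B := B)
    ⟨fun v => ?_, fun v h h' => Set.disjoint_left.1 h₁₂ h h',
      fun v h h' => Set.disjoint_left.1 h₁B h h', fun v h h' => Set.disjoint_left.1 h₂B h h',
      fun b hb a ha hadj => hom₁ b hb ⟨a, ha, hadj⟩,
      fun b hb a ha hadj => hom₂ b hb ⟨a, ha, hadj⟩⟩ (fun x z => ?_) hb hb' hbb'
  · have : v ∈ A₁ ∪ A₂ ∪ B := hcov ▸ Set.mem_univ v
    simpa only [Set.mem_union, or_assoc] using this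
  · by_contra! hcon
    have hsub : A₁ ∪ A₂ ⊆ {x, z} := fun v hv => by
      by_cases hvx : v = x
      exacts [Or.inl hvx, Or.inr (hcon v hv hvx)]
    have h1 := Set.ncard_le_ncard hsub (Set.toFinite _)
    have h2 := Set.ncard_insert_le x {z}
    rw [Set.ncard_singleton] at h2
    rw [Set.ncard_union_eq h₁₂ (Set.toFinite _) (Set.toFinite _)] at h1
    omega
end
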